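/- arXiv:1805.09079 — 2 statements merged into one kernel-verified Lean document; each statement's English description precedes it below -/
import Mathlib

section
/- Let $M$ be an $n\times n$ random matrix whose entries are i.i.d., each taking the value $0$ with probability $1/2$ and each of the values $1$ and $-1$ with probability $1/4$. Then $\lim_{n\to\infty}\mathbb{P}(\exists k\in\mathbb{Z}\text{ such that }\det M=k^{2})=0$. -/
open MeasureTheory

/-- The law of a single entry: `0` with probability `1/2`, `1` and `-1` with
probability `1/4` each. -/
noncomputable def entryMeasure : Measure ℤ :=
  (1/2 : ENNReal) • Measure.dirac 0 + (1/4 : ENNReal) • Measure.dirac 1 +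
    (1/4 : ENNReal) • Measure.dirac (-1)

instance : IsProbabilityMeasure entryMeasure := by
  constructor
  simp only [entryMeasure, Measure.add_apply, Measure.smul_apply, measure_univ, smul_eq_mul,
    mul_one, one_div]
  have h4 : (4⁻¹ + 4⁻¹ : ENNReal) = 2⁻¹ := by
    rw [← two_mul, show (4 : ENNReal) = 2 * 2 by norm_num,
      ENNReal.mul_inv (by norm_num) (by norm_num), ← mul_assoc,
      ENNReal.mul_inv_cancel (by norm_num) (by norm_num), one_mul]
  rw [add_assoc, h4, ENNReal.inv_two_add_inv_two]

/-- The joint law of `n` i.i.d. entries. -/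
noncomputable def vecMeasure (n : ℕ) : Measure (Fin n → ℤ) :=
  Measure.pi fun _ => entryMeasure

instance (n : ℕ) : IsProbabilityMeasure (vecMeasure n) := by
  unfold vecMeasure; infer_instance

/-- The law of an `n × n` random matrix (given as a function of its rows) with
i.i.d. entries distributed according to `entryMeasure`. -/
noncomputable def matMeasure (n : ℕ) : Measure (Fin n → Fin n → ℤ) :=
  Measure.pi fun _ => vecMeasure n

instance (n : ℕ) : IsProbabilityMeasure (matMeasure n) := by
  unfold matMeasure; infer_instance

/-- The characteristic function of an entry reduced modulo `m`, at the frequency `z`. -/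
noncomputable def entryChar (m : ℕ) [NeZero m] (z : ZMod m) : ℝ :=
  (1 + (ZMod.stdAddChar z).re) / 2

section Fourier

variable {m : ℕ} [NeZero m]

lemma entryChar_nonneg (z : ZMod m) : 0 ≤ entryChar m z := by
  have h := Complex.abs_re_le_norm (ZMod.stdAddChar z)
  rw [AddChar.norm_apply, abs_le] at h
  unfold entryChar
  linarith

lemma entryChar_le_one (z : ZMod m) : entryChar m z ≤ 1 := by
  have h := Complex.abs_re_le_norm (ZMod.stdAddChar z)
  rw [AddChar.norm_apply, abs_le] at h
  unfold entryChar
  linarith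

lemma entryChar_lt_one {z : ZMod m} (hz : z ≠ 0) : entryChar m z < 1 := by
  refine lt_of_le_of_ne (entryChar_le_one z) fun h => hz ?_
  have hre : (ZMod.stdAddChar z).re = 1 := by
    unfold entryChar at h
    linarith
  have hnorm : ‖ZMod.stdAddChar z‖ = 1 := AddChar.norm_apply _ z
  have him : (ZMod.stdAddChar z).im = 0 := by
    have := Complex.sq_norm (ZMod.stdAddChar z)
    rw [Complex.normSq_apply, hnorm, hre] at this
    nlinarith
  apply ZMod.injective_stdAddChar
  rw [AddChar.map_zero_eq_one]
  exact Complex.ext hre him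

lemma integral_entryMeasure (f : ℤ → ℂ) :
    ∫ x, f x ∂entryMeasure = 1 / 2 * f 0 + 1 / 4 * f 1 + 1 / 4 * f (-1) := by
  have hintegrable (c : ENNReal) (hc : c ≠ ⊤) (a : ℤ) : Integrable f (c • Measure.dirac a) :=
    (integrable_dirac (by simp [enorm_lt_top])).smul_measure hc
  have h2 := hintegrable (1 / 2) (by simp) 0
  have h4 := hintegrable (1 / 4) (by simp) 1
  have h4' := hintegrable (1 / 4) (by simp) (-1)
  unfold entryMeasure
  rw [integral_add_measure (h2.add_measure h4) h4', integral_add_measure h2 h4]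
  simp [integral_smul_measure]

lemma integral_stdAddChar_mul (z : ZMod m) :
    ∫ x : ℤ, (ZMod.stdAddChar (z * (x : ZMod m)) : ℂ) ∂entryMeasure = entryChar m z := by
  rw [integral_entryMeasure]
  simp only [Int.cast_zero, mul_zero, AddChar.map_zero_eq_one, Int.cast_one, mul_one, Int.cast_neg,
    mul_neg, AddChar.map_neg_eq_conj]
  have h := Complex.add_conj (ZMod.stdAddChar z)
  unfold entryChar
  push_cast at h ⊢
  linear_combination (1 / 4 : ℂ) * h

lemma map_sum_eq_prod_stdAddChar {ι : Type*} (s : Finset ι) (f : ι → ZMod m) :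
    ZMod.stdAddChar (∑ i ∈ s, f i) = ∏ i ∈ s, ZMod.stdAddChar (f i) := by
  classical
  induction s using Finset.induction_on with
  | empty => simp
  | insert i s hi ih => rw [Finset.sum_insert hi, Finset.prod_insert hi, AddChar.map_add_eq_mul, ih]

lemma integral_stdAddChar_sum {n : ℕ} (w : Fin n → ZMod m) (t : ZMod m) :
    ∫ x : Fin n → ℤ, (ZMod.stdAddChar (t * ∑ j, (x j : ZMod m) * w j) : ℂ) ∂vecMeasure n =
      ∏ j, (entryChar m (t * w j) : ℂ) := by
  simp only [← integral_stdAddChar_mul]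
  unfold vecMeasure
  rw [← integral_fintype_prod_eq_prod]
  congr 1
  ext x
  rw [Finset.mul_sum, map_sum_eq_prod_stdAddChar]
  refine Finset.prod_congr rfl fun j _ => ?_
  congr 1
  ring

lemma vecMeasure_real_eq_sum {n : ℕ} (w : Fin n → ZMod m) (a : ZMod m) :
    (((vecMeasure n).real {x | ∑ j, (x j : ZMod m) * w j = a} : ℝ) : ℂ) =
      1 / m * ∑ t : ZMod m, ZMod.stdAddChar (-(t * a)) * ∏ j, (entryChar m (t * w j) : ℂ) := by
  have hm : (m : ℂ) ≠ 0 := Nat.cast_ne_zero.2 (NeZero.ne m)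
  have hintegrable (t : ZMod m) : Integrable
      (fun x : Fin n → ℤ => (ZMod.stdAddChar (t * ∑ j, (x j : ZMod m) * w j) : ℂ))
      (vecMeasure n) :=
    Integrable.of_bound (Measurable.of_discrete.aestronglyMeasurable) 1
      (.of_forall fun x => (AddChar.norm_apply _ _).le)
  simp only [← integral_stdAddChar_sum, ← integral_const_mul]
  rw [← integral_finsetSum _ fun t _ => (hintegrable t).const_mul _, ← integral_const_mul]
  have hind := integral_indicator_const (μ := vecMeasure n) (1 : ℂ)
    (MeasurableSet.of_discrete (s := {x : Fin n → ℤ | ∑ j, (x j : ZMod m) * w j = a}))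
  rw [Complex.real_smul, mul_one] at hind
  rw [← hind]
  congr 1
  ext x
  have h := AddChar.sum_mulShift ((∑ j, (x j : ZMod m) * w j) - a) (ZMod.isPrimitive_stdAddChar m)
  simp only [← AddChar.map_add_eq_mul]
  simp only [show ∀ t : ZMod m, -(t * a) + t * ∑ j, (x j : ZMod m) * w j =
    t * ((∑ j, (x j : ZMod m) * w j) - a) from fun t => by ring, h, sub_eq_zero, ZMod.card]
  by_cases hx : ∑ j, (x j : ZMod m) * w j = a <;> simp [Set.indicator, hx, hm]

lemma vecMeasure_real_le_sum {n : ℕ} (w : Fin n → ZMod m) (a : ZMod m) :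
    (vecMeasure n).real {x | ∑ j, (x j : ZMod m) * w j = a} ≤
      1 / m * ∑ t : ZMod m, ∏ j, entryChar m (t * w j) := by
  have hm : (0 : ℝ) < m := Nat.cast_pos.2 (NeZero.pos m)
  have h := congrArg norm (vecMeasure_real_eq_sum w a)
  rw [Complex.norm_real, Real.norm_of_nonneg measureReal_nonneg] at h
  rw [h, norm_mul]
  refine mul_le_mul (by simp) ((norm_sum_le _ _).trans (Finset.sum_le_sum fun t _ => ?_))
    (norm_nonneg _) (by positivity)
  rw [norm_mul, AddChar.norm_apply, one_mul, norm_prod]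
  refine (Finset.prod_congr rfl fun j _ => ?_).le
  rw [Complex.norm_real, Real.norm_of_nonneg (entryChar_nonneg _)]

/-- A nontrivial linear form takes each value modulo `m` with probability at most `1 / 2`. -/
lemma vecMeasure_real_le_half {n : ℕ} {w : Fin n → ZMod m} (hw : w ≠ 0) (a : ZMod m) :
    (vecMeasure n).real {x | ∑ j, (x j : ZMod m) * w j = a} ≤ 1 / 2 := by
  have hm : (0 : ℝ) < m := Nat.cast_pos.2 (NeZero.pos m)
  obtain ⟨i, hi⟩ := Function.ne_iff.1 hw
  have hsum : ∑ t : ZMod m, entryChar m (t * w i) = m / 2 := by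
    have h := AddChar.sum_mulShift (w i) (ZMod.isPrimitive_stdAddChar m)
    rw [if_neg (by simpa using hi), Nat.cast_zero] at h
    have h' := congrArg Complex.re h
    rw [Complex.re_sum, Complex.zero_re] at h'
    simp only [entryChar, ← Finset.sum_div, Finset.sum_add_distrib, h', Finset.sum_const,
      Finset.card_univ, ZMod.card, nsmul_eq_mul]
    ring
  calc _ ≤ 1 / m * ∑ t : ZMod m, ∏ j, entryChar m (t * w j) := vecMeasure_real_le_sum w a
    _ ≤ 1 / m * ∑ t : ZMod m, entryChar m (t * w i) := by
        gcongr with t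
        rw [← Finset.mul_prod_erase _ _ (Finset.mem_univ i)]
        exact mul_le_of_le_one_right (entryChar_nonneg _)
          (Finset.prod_le_one (fun _ _ => entryChar_nonneg _) fun _ _ => entryChar_le_one _)
    _ = 1 / 2 := by rw [hsum]; field_simp

variable (m) in
lemma exists_entryChar_le : ∃ ρ : ℝ, 0 ≤ ρ ∧ ρ < 1 ∧ ∀ z : ZMod m, z ≠ 0 → entryChar m z ≤ ρ := by
  by_cases h : ∃ z : ZMod m, z ≠ 0
  · obtain ⟨z, hz, hmax⟩ := Finset.exists_max_image (Finset.univ.filter fun z : ZMod m => z ≠ 0)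
      (entryChar m) (by simpa [Finset.Nonempty] using h)
    refine ⟨entryChar m z, entryChar_nonneg _, entryChar_lt_one (by simpa using hz), fun y hy => ?_⟩
    exact hmax y (by simpa using hy)
  · exact ⟨0, le_rfl, one_pos, fun z hz => (h ⟨z, hz⟩).elim⟩

variable (m) in
/-- A linear form all of whose nontrivial multiples have a positive proportion of nonzero
coefficients is exponentially close to equidistributed modulo `m`. -/
lemma exists_vecMeasure_real_le {d : ℕ} (hd : 0 < d) :
    ∃ σ : ℝ, 0 ≤ σ ∧ σ < 1 ∧ ∀ (n : ℕ) (w : Fin n → ZMod m) (a : ZMod m),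
      (∀ t : ZMod m, t ≠ 0 → n ≤ d * (Finset.univ.filter fun j => t * w j ≠ 0).card) →
        (vecMeasure n).real {x | ∑ j, (x j : ZMod m) * w j = a} ≤ 1 / m + σ ^ n := by
  obtain ⟨ρ, hρ0, hρ1, hρ⟩ := exists_entryChar_le m
  have hm : (0 : ℝ) < m := Nat.cast_pos.2 (NeZero.pos m)
  have hd' : (1 : ℝ) ≤ d := by exact_mod_cast hd
  set σ : ℝ := 1 - (1 - ρ) / d with hσ
  have hquot : (1 - ρ) / d ≤ 1 - ρ := div_le_self (by linarith) hd'
  have hquot0 : 0 < (1 - ρ) / d := div_pos (by linarith) (by linarith)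
  have hσ0 : 0 ≤ σ := by linarith
  have hσ1 : σ < 1 := by linarith
  have hρσ : ρ ≤ σ ^ d := by
    have h := one_add_mul_le_pow (a := -((1 - ρ) / d)) (by linarith) d
    have hcancel : (d : ℝ) * -((1 - ρ) / d) = -(1 - ρ) := by field_simp
    rw [hcancel, ← sub_eq_add_neg, ← sub_eq_add_neg, ← hσ] at h
    linarith
  refine ⟨σ, hσ0, hσ1, fun n w a hw => (vecMeasure_real_le_sum w a).trans ?_⟩
  have hterm (t : ZMod m) (ht : t ≠ 0) : ∏ j, entryChar m (t * w j) ≤ σ ^ n := by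
    calc ∏ j, entryChar m (t * w j) ≤ ∏ j, if t * w j ≠ 0 then σ ^ d else 1 := by
          refine Finset.prod_le_prod (fun _ _ => entryChar_nonneg _) fun j _ => ?_
          split_ifs with h
          · exact (hρ _ h).trans hρσ
          · exact entryChar_le_one _
      _ = σ ^ (d * (Finset.univ.filter fun j => t * w j ≠ 0).card) := by
          rw [Finset.prod_ite]
          simp [pow_mul]
      _ ≤ σ ^ n := pow_le_pow_of_le_one hσ0 hσ1.le (hw t ht)
  have hsum : ∑ t : ZMod m, ∏ j, entryChar m (t * w j) ≤ 1 + m * σ ^ n := by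
    rw [← Finset.add_sum_erase _ _ (Finset.mem_univ (0 : ZMod m))]
    refine add_le_add (Finset.prod_le_one (fun _ _ => entryChar_nonneg _)
      fun _ _ => entryChar_le_one _) ?_
    refine (Finset.sum_le_card_nsmul _ _ (σ ^ n) fun t ht =>
      hterm t (Finset.ne_of_mem_erase ht)).trans ?_
    rw [nsmul_eq_mul]
    gcongr
    exact (Finset.card_le_univ _).trans (ZMod.card m).le
  calc _ ≤ 1 / (m : ℝ) * (1 + m * σ ^ n) := by gcongr
    _ = 1 / m + σ ^ n := by field_simp

end Fourier

section Squares

lemma ncard_isSquare_mul_le {m n : ℕ} [NeZero m] [NeZero n] (h : m.Coprime n) :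
    {a : ZMod (m * n) | IsSquare a}.ncard ≤
      {a : ZMod m | IsSquare a}.ncard * {a : ZMod n | IsSquare a}.ncard := by
  rw [← Set.ncard_prod]
  refine Set.ncard_le_ncard_of_injOn (ZMod.chineseRemainder h) (fun a ha => ?_)
    (ZMod.chineseRemainder h).injective.injOn (Set.toFinite _)
  have hsq := IsSquare.map (ZMod.chineseRemainder h) ha
  exact ⟨hsq.map (RingHom.fst _ _), hsq.map (RingHom.snd _ _)⟩

lemma ncard_isSquare_le (m : ℕ) [NeZero m] :
    {a : ZMod m | IsSquare a}.ncard ≤ m / 2 + 1 := by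
  have hsub : {a : ZMod m | IsSquare a} ⊆
      ((Finset.range (m / 2 + 1)).image fun r : ℕ => (r : ZMod m) ^ 2 : Finset (ZMod m)) := by
    rintro a ⟨b, rfl⟩
    rw [Finset.coe_image]
    refine ⟨b.valMinAbs.natAbs, ?_, ?_⟩
    · simpa [Nat.lt_succ_iff] using ZMod.natAbs_valMinAbs_le b
    · have h : ((b.valMinAbs.natAbs : ℤ) : ZMod m) ^ 2 = b ^ 2 := by
        rw [← Int.cast_pow, Int.natAbs_sq, Int.cast_pow, ZMod.coe_valMinAbs]
      rw [← pow_two, ← h, Int.cast_natCast]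
  calc _ ≤ _ := Set.ncard_le_ncard hsub (Finset.finite_toSet _)
    _ ≤ m / 2 + 1 := by
      rw [Set.ncard_coe_finset]
      exact Finset.card_image_le.trans (Finset.card_range _).le

lemma ncard_isSquare_prod_le {S : Finset ℕ} (hS : ∀ p ∈ S, p.Prime ∧ 6 ≤ p) :
    ({a : ZMod (∏ p ∈ S, p) | IsSquare a}.ncard : ℝ) ≤
      (2 / 3) ^ S.card * ((∏ p ∈ S, p : ℕ) : ℝ) := by
  induction S using Finset.induction_on with
  | empty =>
    simpa using Set.subsingleton_of_subsingleton
  | insert q S hq ih =>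
    have hS' : ∀ p ∈ S, p.Prime ∧ 6 ≤ p := fun p hp => hS p (Finset.mem_insert_of_mem hp)
    obtain ⟨hqp, hq6⟩ := hS q (Finset.mem_insert_self q S)
    have : NeZero q := ⟨hqp.ne_zero⟩
    have : NeZero (∏ p ∈ S, p) := ⟨Finset.prod_ne_zero_iff.2 fun p hp => (hS' p hp).1.ne_zero⟩
    have hcop : q.Coprime (∏ p ∈ S, p) := Nat.Coprime.prod_right fun p hp =>
      (Nat.coprime_primes hqp (hS' p hp).1).2 fun h => hq (h ▸ hp)
    rw [Finset.prod_insert hq, Finset.card_insert_of_notMem hq]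
    have hq' : ({a : ZMod q | IsSquare a}.ncard : ℝ) ≤ 2 / 3 * q := by
      have h : 3 * {a : ZMod q | IsSquare a}.ncard ≤ 2 * q := by
        have := ncard_isSquare_le q
        omega
      have h' : (3 : ℝ) * {a : ZMod q | IsSquare a}.ncard ≤ 2 * q := by exact_mod_cast h
      linarith
    calc ({a : ZMod (q * ∏ p ∈ S, p) | IsSquare a}.ncard : ℝ)
        ≤ ({a : ZMod q | IsSquare a}.ncard : ℝ) *
            ({a : ZMod (∏ p ∈ S, p) | IsSquare a}.ncard : ℝ) := by
          exact_mod_cast ncard_isSquare_mul_le hcop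
      _ ≤ (2 / 3 * q) * ((2 / 3) ^ S.card * ((∏ p ∈ S, p : ℕ) : ℝ)) := by
          gcongr
          exact ih hS'
      _ = _ := by push_cast; ring

end Squares

section Cofactor

variable {A : Type*} [CommRing A] {N : ℕ}

/-- The signed maximal minors of an `N × (N + 1)` matrix given by its rows. -/
def cofactorVec (R : Fin N → Fin (N + 1) → A) (j : Fin (N + 1)) : A :=
  (-1) ^ (j : ℕ) * ((Matrix.of R).submatrix id j.succAbove).det

lemma det_cons_eq_sum (x : Fin (N + 1) → A) (R : Fin N → Fin (N + 1) → A) :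
    (Matrix.of (Fin.cons x R : Fin (N + 1) → Fin (N + 1) → A)).det =
      ∑ j, x j * cofactorVec R j := by
  rw [Matrix.det_succ_row_zero]
  refine Finset.sum_congr rfl fun j _ => ?_
  have hsub : (Matrix.of (Fin.cons x R : Fin (N + 1) → Fin (N + 1) → A)).submatrix
      Fin.succ j.succAbove = (Matrix.of R).submatrix id j.succAbove := by
    ext i k
    simp
  rw [hsub, cofactorVec, Matrix.of_apply, Fin.cons_zero]
  ring

lemma sum_mul_cofactorVec_eq_zero (R : Fin N → Fin (N + 1) → A) (i : Fin N) :
    ∑ j, R i j * cofactorVec R j = 0 := by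
  rw [← det_cons_eq_sum]
  refine Matrix.det_zero_of_row_eq (i := 0) (j := i.succ) (Fin.succ_ne_zero i).symm ?_
  ext k
  simp [Matrix.of_apply]

lemma map_cofactorVec {B : Type*} [CommRing B] (f : A →+* B) (R : Fin N → Fin (N + 1) → A)
    (j : Fin (N + 1)) : f (cofactorVec R j) = cofactorVec (fun i k => f (R i k)) j := by
  simp only [cofactorVec, map_mul, map_pow, map_neg, map_one, RingHom.map_det]
  rfl

/-- If all maximal minors vanish, then the rows are linearly dependent. -/
lemma exists_sum_mul_eq_zero_of_cofactorVec_eq_zero {K : Type*} [Field K]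
    (R : Fin N → Fin (N + 1) → K) (h : cofactorVec R = 0) :
    ∃ u : Fin N → K, u ≠ 0 ∧ ∀ j, ∑ i, R i j * u i = 0 := by
  by_cases hli : LinearIndependent K R
  · have hspan : Submodule.span K (Set.range R) ≠ ⊤ := fun htop => by
      have hrank := finrank_span_eq_card hli
      rw [htop, finrank_top] at hrank
      simp at hrank
    obtain ⟨x, hx⟩ : ∃ x, x ∉ Submodule.span K (Set.range R) := by
      by_contra! hall
      exact hspan (Submodule.eq_top_iff'.2 hall)
    have hcons := linearIndependent_finCons.2 ⟨hli, hx⟩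
    have hunit : IsUnit (Matrix.of (Fin.cons x R : Fin (N + 1) → Fin (N + 1) → K)) :=
      Matrix.linearIndependent_rows_iff_isUnit.1 hcons
    rw [Matrix.isUnit_iff_isUnit_det, det_cons_eq_sum, h] at hunit
    simp at hunit
  · obtain ⟨u, hu, i, hi⟩ := Fintype.not_linearIndependent_iff.1 hli
    refine ⟨u, fun h0 => hi (congrFun h0 i), fun j => ?_⟩
    simpa [mul_comm] using congrFun hu j

end Cofactor

section Sparse

/-- The number of nonzero coordinates of a vector modulo `m`. -/
def weight {m n : ℕ} (w : Fin n → ZMod m) : ℕ :=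
  (Finset.univ.filter fun j => w j ≠ 0).card

lemma exists_card_weight_le (m : ℕ) [NeZero m] :
    ∃ d : ℕ, 0 < d ∧ ∀ n : ℕ,
      ((Finset.univ.filter fun w : Fin n → ZMod m => d * weight w ≤ n).card : ℝ) ≤
        (25 / 16) ^ n := by
  have hm : (0 : ℝ) < m := Nat.cast_pos.2 (NeZero.pos m)
  obtain ⟨d, hd⟩ := exists_pow_lt_of_lt_one (show (0 : ℝ) < 1 / (4 * m) by positivity)
    (show (4 / 5 : ℝ) < 1 by norm_num)
  have hd1 : 0 < d := by
    rcases Nat.eq_zero_or_pos d with rfl | h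
    · have hm1 : (1 : ℝ) ≤ m := by exact_mod_cast NeZero.pos m
      rw [pow_zero, lt_div_iff₀ (by positivity)] at hd
      linarith
    · exact h
  refine ⟨d, hd1, fun n => ?_⟩
  set q : ℝ := (4 / 5) ^ d with hq
  have hq0 : 0 < q := by positivity
  have hmq : m * q ≤ 1 / 4 := by
    rw [lt_div_iff₀ (by positivity)] at hd
    linarith
  have hprod (w : Fin n → ZMod m) :
      ∏ j, (if w j ≠ 0 then q else 1) = (4 / 5 : ℝ) ^ (d * weight w) := by
    rw [Finset.prod_ite]
    simp [weight, hq, pow_mul]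
  calc ((Finset.univ.filter fun w : Fin n → ZMod m => d * weight w ≤ n).card : ℝ)
      = ∑ w ∈ Finset.univ.filter fun w : Fin n → ZMod m => d * weight w ≤ n, (1 : ℝ) := by simp
    _ ≤ ∑ w ∈ Finset.univ.filter fun w : Fin n → ZMod m => d * weight w ≤ n,
          (5 / 4 : ℝ) ^ n * ∏ j, (if w j ≠ 0 then q else 1) := by
        refine Finset.sum_le_sum fun w hw => ?_
        rw [hprod]
        have hw' : d * weight w ≤ n := (Finset.mem_filter.1 hw).2
        have h : (4 / 5 : ℝ) ^ n ≤ (4 / 5 : ℝ) ^ (d * weight w) :=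
          pow_le_pow_of_le_one (by norm_num) (by norm_num) hw'
        calc (1 : ℝ) = (5 / 4) ^ n * (4 / 5) ^ n := by rw [← mul_pow]; norm_num
          _ ≤ _ := by gcongr
    _ ≤ ∑ w : Fin n → ZMod m, (5 / 4 : ℝ) ^ n * ∏ j, (if w j ≠ 0 then q else 1) := by
        refine Finset.sum_le_sum_of_subset_of_nonneg (Finset.filter_subset _ _) fun w _ _ => ?_
        rw [hprod]
        positivity
    _ = (5 / 4 : ℝ) ^ n * (∑ z : ZMod m, if z ≠ 0 then q else 1) ^ n := by
        rw [← Finset.mul_sum, ← Fintype.piFinset_univ,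
          ← Finset.prod_univ_sum (fun _ => Finset.univ)
            (fun (_ : Fin n) (z : ZMod m) => if z ≠ 0 then q else 1)]
        simp
    _ ≤ (5 / 4 : ℝ) ^ n * (5 / 4) ^ n := by
        have hle : (∑ z : ZMod m, if z ≠ 0 then q else 1) ≤ 5 / 4 := by
          rw [← Finset.add_sum_erase _ _ (Finset.mem_univ (0 : ZMod m))]
          have h := Finset.sum_le_card_nsmul (Finset.univ.erase (0 : ZMod m))
            (fun z => if z ≠ 0 then q else 1) q fun z hz => by
              rw [if_pos (Finset.ne_of_mem_erase hz)]
          rw [nsmul_eq_mul] at h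
          have hcard : ((Finset.univ.erase (0 : ZMod m)).card : ℝ) ≤ m := by
            exact_mod_cast (Finset.card_le_univ _).trans (ZMod.card m).le
          have h' := mul_le_mul_of_nonneg_right hcard hq0.le
          simp only [ne_eq, not_true_eq_false, if_false]
          linarith
        have h0 : 0 ≤ ∑ z : ZMod m, if z ≠ 0 then q else 1 :=
          Finset.sum_nonneg fun z _ => by split_ifs <;> linarith
        gcongr
    _ = (25 / 16) ^ n := by rw [← mul_pow]; norm_num

end Sparse

section Kernels

/-- The law of an `a × b` random matrix with independent entries. -/
noncomputable def rectMeasure (a b : ℕ) : Measure (Fin a → Fin b → ℤ) :=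
  Measure.pi fun _ => vecMeasure b

instance (a b : ℕ) : IsProbabilityMeasure (rectMeasure a b) := by
  unfold rectMeasure; infer_instance

lemma rectMeasure_real_forall_row {a b : ℕ} (s : Set (Fin b → ℤ)) :
    (rectMeasure a b).real {R | ∀ i, R i ∈ s} = (vecMeasure b).real s ^ a := by
  have hset : {R : Fin a → Fin b → ℤ | ∀ i, R i ∈ s} = Set.univ.pi fun _ => s := by
    ext R
    simp
  rw [hset, measureReal_def, rectMeasure, Measure.pi_pi, ENNReal.toReal_prod, Finset.prod_const,
    Finset.card_univ, Fintype.card_fin]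
  rfl

lemma map_transpose_rectMeasure (a b : ℕ) :
    (rectMeasure a b).map (fun R j i => R i j) = rectMeasure b a := by
  refine Measure.ext_of_singleton fun C => ?_
  rw [Measure.map_apply .of_discrete .of_discrete]
  have hpre : (fun (R : Fin a → Fin b → ℤ) j i => R i j) ⁻¹' {C} = {fun i j => C j i} := by
    ext R
    simp only [Set.mem_preimage, Set.mem_singleton_iff, funext_iff]
    exact forall_comm
  simp only [hpre, rectMeasure, vecMeasure, Measure.pi_singleton]
  exact Finset.prod_comm

lemma rectMeasure_real_forall_col {a b : ℕ} (s : Set (Fin a → ℤ)) :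
    (rectMeasure a b).real {R | ∀ j, (fun i => R i j) ∈ s} = (vecMeasure a).real s ^ b := by
  rw [← rectMeasure_real_forall_row, ← map_transpose_rectMeasure,
    map_measureReal_apply .of_discrete .of_discrete]
  rfl

variable {p : ℕ} [NeZero p]

lemma rectMeasure_real_exists_sparse_kernel_le {a b d : ℕ} :
    (rectMeasure a b).real
        {R | ∃ w : Fin b → ZMod p, w ≠ 0 ∧ d * weight w ≤ b ∧ ∀ i, ∑ j, (R i j : ZMod p) * w j = 0} ≤
      (Finset.univ.filter fun w : Fin b → ZMod p => d * weight w ≤ b).card * (1 / 2) ^ a := by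
  set F := Finset.univ.filter fun w : Fin b → ZMod p => w ≠ 0 ∧ d * weight w ≤ b with hF
  calc _ ≤ (rectMeasure a b).real (⋃ w ∈ F,
        {R | ∀ i, R i ∈ {x : Fin b → ℤ | ∑ j, (x j : ZMod p) * w j = 0}}) := by
        refine measureReal_mono ?_ (measure_ne_top _ _)
        rintro R ⟨w, hw0, hw, hR⟩
        exact Set.mem_iUnion₂.2 ⟨w, by simp [hF, hw0, hw], hR⟩
    _ ≤ ∑ w ∈ F, (1 / 2 : ℝ) ^ a := by
        refine (measureReal_biUnion_finset_le _ _).trans (Finset.sum_le_sum fun w hw => ?_)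
        rw [rectMeasure_real_forall_row]
        exact pow_le_pow_left₀ measureReal_nonneg
          (vecMeasure_real_le_half (Finset.mem_filter.1 hw).2.1 0) a
    _ ≤ _ := by
        rw [Finset.sum_const, nsmul_eq_mul]
        gcongr
        exact fun w hw => by simpa using (Finset.mem_filter.1 hw).2.2

lemma rectMeasure_real_exists_left_kernel_le {a b d : ℕ} {δ : ℝ} (hδ0 : 0 ≤ δ)
    (hδ : ∀ u : Fin a → ZMod p, a ≤ d * weight u →
      (vecMeasure a).real {x | ∑ i, (x i : ZMod p) * u i = 0} ≤ δ) :
    (rectMeasure a b).real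
        {R | ∃ u : Fin a → ZMod p, u ≠ 0 ∧ ∀ j, ∑ i, (R i j : ZMod p) * u i = 0} ≤
      (Finset.univ.filter fun u : Fin a → ZMod p => d * weight u ≤ a).card * (1 / 2) ^ b +
        p ^ a * δ ^ b := by
  calc _ ≤ (rectMeasure a b).real (⋃ u ∈ Finset.univ.filter fun u : Fin a → ZMod p => u ≠ 0,
        {R | ∀ j, (fun i => R i j) ∈ {x : Fin a → ℤ | ∑ i, (x i : ZMod p) * u i = 0}}) := by
        refine measureReal_mono ?_ (measure_ne_top _ _)
        rintro R ⟨u, hu0, hR⟩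
        exact Set.mem_iUnion₂.2 ⟨u, by simp [hu0], hR⟩
    _ ≤ ∑ u ∈ Finset.univ.filter fun u : Fin a → ZMod p => u ≠ 0,
          ((if d * weight u ≤ a then (1 / 2 : ℝ) ^ b else 0) + δ ^ b) := by
        refine (measureReal_biUnion_finset_le _ _).trans (Finset.sum_le_sum fun u hu => ?_)
        rw [rectMeasure_real_forall_col]
        split_ifs with h
        · exact le_add_of_le_of_nonneg (pow_le_pow_left₀ measureReal_nonneg
            (vecMeasure_real_le_half (Finset.mem_filter.1 hu).2 0) b) (by positivity)
        · rw [zero_add]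
          exact pow_le_pow_left₀ measureReal_nonneg (hδ u (not_le.1 h).le) b
    _ ≤ ∑ u : Fin a → ZMod p, ((if d * weight u ≤ a then (1 / 2 : ℝ) ^ b else 0) + δ ^ b) := by
        refine Finset.sum_le_sum_of_subset_of_nonneg (Finset.filter_subset _ _) fun u _ _ => ?_
        split_ifs <;> positivity
    _ = _ := by
        rw [Finset.sum_add_distrib, ← Finset.sum_filter]
        simp [ZMod.card]

end Kernels

section Cofactors

open Filter Topology

lemma tendsto_one_add_mul_pow_pow {σ c : ℝ} (hσ0 : 0 ≤ σ) (hσ1 : σ < 1) (hc : 0 ≤ c) :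
    Tendsto (fun N : ℕ => (1 + c * σ ^ N) ^ (N + 1)) atTop (𝓝 1) := by
  have h1 := tendsto_self_mul_const_pow_of_lt_one hσ0 hσ1
  have h2 := tendsto_pow_atTop_nhds_zero_of_lt_one hσ0 hσ1
  have h3 : Tendsto (fun N : ℕ => Real.exp (c * (N * σ ^ N + σ ^ N))) atTop (𝓝 1) := by
    have h := (Real.continuous_exp.tendsto _).comp ((h1.add h2).const_mul c)
    simpa [Function.comp_def] using h
  refine tendsto_of_tendsto_of_tendsto_of_le_of_le tendsto_const_nhds h3 (fun N => ?_) fun N => ?_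
  · exact one_le_pow₀ (le_add_of_nonneg_right (by positivity))
  · calc (1 + c * σ ^ N) ^ (N + 1) ≤ Real.exp (c * σ ^ N) ^ (N + 1) := by
          gcongr
          rw [add_comm]
          exact Real.add_one_le_exp _
      _ = Real.exp (c * (N * σ ^ N + σ ^ N)) := by
          rw [← Real.exp_nat_mul]
          congr 1
          push_cast
          ring

/-- With probability close to `1`, the vector of signed maximal minors of an `N × (N + 1)` matrix
has a positive proportion of coordinates prime to `p`. -/
lemma exists_eventually_weight_cofactorVec (p : ℕ) [Fact p.Prime] :
    ∃ d : ℕ, ∀ᶠ N : ℕ in atTop, (rectMeasure N (N + 1)).real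
      {R | d * weight (fun j => ((cofactorVec R j : ℤ) : ZMod p)) ≤ N + 1} ≤ 2 / p := by
  obtain ⟨d, hd, hcard⟩ := exists_card_weight_le p
  obtain ⟨σ, hσ0, hσ1, hσ⟩ := exists_vecMeasure_real_le p hd
  refine ⟨d, ?_⟩
  have hp : (0 : ℝ) < p := Nat.cast_pos.2 (NeZero.pos p)
  have hbound (N : ℕ) : (rectMeasure N (N + 1)).real
      {R | d * weight (fun j => ((cofactorVec R j : ℤ) : ZMod p)) ≤ N + 1} ≤
        25 / 16 * (25 / 32) ^ N + (1 / 2 * (25 / 32) ^ N + 1 / p * (1 + p * σ ^ N) ^ (N + 1)) := by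
    have hsub : {R : Fin N → Fin (N + 1) → ℤ |
        d * weight (fun j => ((cofactorVec R j : ℤ) : ZMod p)) ≤ N + 1} ⊆
          {R | ∃ w : Fin (N + 1) → ZMod p, w ≠ 0 ∧ d * weight w ≤ N + 1 ∧
            ∀ i, ∑ j, (R i j : ZMod p) * w j = 0} ∪
          {R | ∃ u : Fin N → ZMod p, u ≠ 0 ∧ ∀ j, ∑ i, (R i j : ZMod p) * u i = 0} := by
      intro R hR
      by_cases h0 : (fun j => ((cofactorVec R j : ℤ) : ZMod p)) = 0
      · right
        refine exists_sum_mul_eq_zero_of_cofactorVec_eq_zero (fun i j => (R i j : ZMod p)) ?_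
        rw [← h0]
        ext j
        exact (map_cofactorVec (Int.castRingHom (ZMod p)) R j).symm
      · refine Or.inl ⟨_, h0, hR, fun i => ?_⟩
        have h := congrArg (Int.cast : ℤ → ZMod p) (sum_mul_cofactorVec_eq_zero R i)
        simpa using h
    have hdense (u : Fin N → ZMod p) (hu : N ≤ d * weight u) :
        (vecMeasure N).real {x | ∑ i, (x i : ZMod p) * u i = 0} ≤ 1 / p + σ ^ N := by
      refine hσ N u 0 fun t ht => ?_
      simpa [ht, weight] using hu
    calc _ ≤ _ := (measureReal_mono hsub).trans (measureReal_union_le _ _)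
      _ ≤ (25 / 16) ^ (N + 1) * (1 / 2) ^ N +
            ((25 / 16) ^ N * (1 / 2) ^ (N + 1) + p ^ N * (1 / p + σ ^ N) ^ (N + 1)) := by
          refine add_le_add (rectMeasure_real_exists_sparse_kernel_le.trans ?_)
            ((rectMeasure_real_exists_left_kernel_le (by positivity) hdense).trans ?_)
          · gcongr
            exact hcard (N + 1)
          · gcongr
            exact hcard N
      _ = _ := by
          have h32 : (25 / 32 : ℝ) ^ N = (25 / 16) ^ N * (1 / 2) ^ N := by
            rw [← mul_pow]
            norm_num
          have hfac : (1 / p + σ ^ N : ℝ) = 1 / p * (1 + p * σ ^ N) := by field_simp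
          have hpp : (p : ℝ) ^ N * (1 / p) ^ (N + 1) = 1 / p := by
            rw [pow_succ, ← mul_assoc, ← mul_pow, mul_one_div_cancel hp.ne', one_pow, one_mul]
          rw [h32, hfac, mul_pow (1 / (p : ℝ)), ← mul_assoc, hpp]
          ring
  have hlim : Tendsto (fun N : ℕ => 25 / 16 * (25 / 32 : ℝ) ^ N +
      (1 / 2 * (25 / 32) ^ N + 1 / p * (1 + p * σ ^ N) ^ (N + 1))) atTop (𝓝 (1 / p)) := by
    have hgeom := tendsto_pow_atTop_nhds_zero_of_lt_one (show (0 : ℝ) ≤ 25 / 32 by norm_num)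
      (by norm_num)
    have h := (hgeom.const_mul (25 / 16)).add ((hgeom.const_mul (1 / 2)).add
      ((tendsto_one_add_mul_pow_pow hσ0 hσ1 hp.le).const_mul (1 / (p : ℝ))))
    simpa using h
  have hlt : (1 / p : ℝ) < 2 / p := by gcongr; norm_num
  filter_upwards [hlim.eventually_lt_const hlt] with N hN
  exact (hbound N).trans hN.le

end Cofactors

section Determinant

open Filter Topology

/-- If all residues of `v` modulo the primes in `S` have large weight, so has every nontrivial
multiple of `v` modulo `∏ p ∈ S, p`. -/
lemma le_mul_card_of_le_mul_weight {S : Finset ℕ} (hS : ∀ p ∈ S, p.Prime) {n D : ℕ}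
    {v : Fin n → ℤ} (hv : ∀ p ∈ S, n ≤ D * weight (fun j => (v j : ZMod p)))
    (t : ZMod (∏ p ∈ S, p)) (ht : t ≠ 0) :
    n ≤ D * (Finset.univ.filter fun j => t * (v j : ZMod (∏ p ∈ S, p)) ≠ 0).card := by
  obtain ⟨t, rfl⟩ := ZMod.intCast_surjective t
  obtain ⟨p, hp, hpt⟩ : ∃ p ∈ S, ¬ (p : ℤ) ∣ t := by
    by_contra! hall
    refine ht ((ZMod.intCast_zmod_eq_zero_iff_dvd _ _).2 ?_)
    rw [Int.natCast_dvd]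
    exact Finset.prod_primes_dvd _ (fun p hp => (hS p hp).prime)
      fun p hp => Int.natCast_dvd.1 (hall p hp)
  refine (hv p hp).trans (Nat.mul_le_mul_left D (Finset.card_le_card fun j hj => ?_))
  simp only [Finset.mem_filter, Finset.mem_univ, true_and, ne_eq] at hj ⊢
  rw [← Int.cast_mul]
  intro h
  have hdvd : (p : ℤ) ∣ t * v j :=
    (Int.natCast_dvd_natCast.2 (Finset.dvd_prod_of_mem _ hp)).trans
      ((ZMod.intCast_zmod_eq_zero_iff_dvd _ _).1 h)
  exact hj ((ZMod.intCast_zmod_eq_zero_iff_dvd _ _).2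
    (((Nat.prime_iff_prime_int.1 (hS p hp)).dvd_or_dvd hdvd).resolve_left hpt))

lemma vecMeasure_real_isSquare_le (m : ℕ) [NeZero m] {n : ℕ} (v : Fin n → ℤ) {δ : ℝ}
    (hδ : ∀ a : ZMod m, (vecMeasure n).real {x | ∑ j, (x j : ZMod m) * (v j : ZMod m) = a} ≤ δ) :
    (vecMeasure n).real {x | ∃ k : ℤ, ∑ j, x j * v j = k ^ 2} ≤
      {a : ZMod m | IsSquare a}.ncard * δ := by
  classical
  calc _ ≤ (vecMeasure n).real (⋃ a ∈ {a : ZMod m | IsSquare a}.toFinset,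
        {x | ∑ j, (x j : ZMod m) * (v j : ZMod m) = a}) := by
        refine measureReal_mono ?_ (measure_ne_top _ _)
        rintro x ⟨k, hk⟩
        refine Set.mem_iUnion₂.2 ⟨(k : ZMod m) ^ 2, by simpa using IsSquare.sq (k : ZMod m), ?_⟩
        have h := congrArg (Int.cast : ℤ → ZMod m) hk
        simpa using h
    _ ≤ ∑ a ∈ {a : ZMod m | IsSquare a}.toFinset, δ :=
        (measureReal_biUnion_finset_le _ _).trans (Finset.sum_le_sum fun a _ => hδ a)
    _ = _ := by rw [Finset.sum_const, nsmul_eq_mul, Set.ncard_eq_toFinset_card']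

lemma matMeasure_real_isSquare_le {N : ℕ} (s : Set (Fin N → Fin (N + 1) → ℤ)) {δ : ℝ}
    (hδ0 : 0 ≤ δ) (hδ : ∀ R ∉ s,
      (vecMeasure (N + 1)).real {x | ∃ k : ℤ, ∑ j, x j * cofactorVec R j = k ^ 2} ≤ δ) :
    (matMeasure (N + 1)).real {M | ∃ k : ℤ, (Matrix.of M).det = k ^ 2} ≤
      (rectMeasure N (N + 1)).real s + δ := by
  set ν := (vecMeasure (N + 1)).prod (rectMeasure N (N + 1)) with hν
  set E : Set ((Fin (N + 1) → ℤ) × (Fin N → Fin (N + 1) → ℤ)) :=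
    {y | ∃ k : ℤ, ∑ j, y.1 j * cofactorVec y.2 j = k ^ 2}
  have : SigmaFinite (vecMeasure (N + 1)) := IsFiniteMeasure.toSigmaFinite _
  have hmp := measurePreserving_piFinSuccAbove (fun _ : Fin (N + 1) => vecMeasure (N + 1)) 0
  have hpre : {M : Fin (N + 1) → Fin (N + 1) → ℤ | ∃ k : ℤ, (Matrix.of M).det = k ^ 2} =
      MeasurableEquiv.piFinSuccAbove (fun _ : Fin (N + 1) => Fin (N + 1) → ℤ) 0 ⁻¹' E := by
    ext M
    have h := det_cons_eq_sum (M 0) (fun i => M i.succ)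
    have hM : (Fin.cons (M 0) (fun i => M i.succ) : Fin (N + 1) → Fin (N + 1) → ℤ) = M :=
      Fin.cons_self_tail M
    rw [hM] at h
    rw [Set.mem_ofPred_eq, h]
    rfl
  have hmat : (matMeasure (N + 1)).real {M | ∃ k : ℤ, (Matrix.of M).det = k ^ 2} = ν.real E := by
    rw [hpre]
    exact hmp.measureReal_preimage MeasurableSet.of_discrete.nullMeasurableSet
  have hsub : E ⊆ Set.univ ×ˢ s ∪ E ∩ Set.univ ×ˢ sᶜ := by
    intro y hy
    by_cases h : y.2 ∈ s
    · exact Or.inl ⟨trivial, h⟩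
    · exact Or.inr ⟨hy, trivial, h⟩
  rw [hmat]
  refine (measureReal_mono hsub).trans ((measureReal_union_le _ _).trans (add_le_add ?_ ?_))
  · rw [hν, measureReal_prod_prod]
    simp
  · refine ENNReal.toReal_le_of_le_ofReal hδ0 ?_
    rw [hν, Measure.prod_apply_symm .of_discrete]
    refine (lintegral_mono fun R => ?_).trans_eq
      ((lintegral_const _).trans (by rw [measure_univ, mul_one]))
    by_cases hR : R ∈ s
    · have : (fun x => (x, R)) ⁻¹' (E ∩ Set.univ ×ˢ sᶜ) = ∅ := by
        ext x
        simp [hR]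
      simp [this]
    · rw [← ofReal_measureReal]
      exact ENNReal.ofReal_le_ofReal
        ((measureReal_mono fun x hx => hx.1).trans (hδ R hR))

lemma eventually_matMeasure_real_isSquare_lt {S : Finset ℕ} (hS : ∀ p ∈ S, p.Prime ∧ 6 ≤ p)
    {ε : ℝ} (hε : 0 < ε) : ∀ᶠ N : ℕ in atTop,
      (matMeasure (N + 1)).real {M | ∃ k : ℤ, (Matrix.of M).det = k ^ 2} <
        ∑ p ∈ S, 2 / (p : ℝ) + (2 / 3) ^ S.card + ε := by
  have hex (p : ℕ) : ∃ d : ℕ, p ∈ S → ∀ᶠ N : ℕ in atTop, (rectMeasure N (N + 1)).real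
      {R | d * weight (fun j => ((cofactorVec R j : ℤ) : ZMod p)) ≤ N + 1} ≤ 2 / p := by
    by_cases hp : p ∈ S
    · have : Fact p.Prime := ⟨(hS p hp).1⟩
      obtain ⟨d, h⟩ := exists_eventually_weight_cofactorVec p
      exact ⟨d, fun _ => h⟩
    · exact ⟨1, fun h => (hp h).elim⟩
  choose d hev using hex
  set m := ∏ p ∈ S, p
  have hm0 : NeZero m := ⟨Finset.prod_ne_zero_iff.2 fun p hp => (hS p hp).1.ne_zero⟩
  have hmpos : (0 : ℝ) < m := Nat.cast_pos.2 (NeZero.pos m)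
  obtain ⟨σ, hσ0, hσ1, hσ⟩ := exists_vecMeasure_real_le m (Nat.succ_pos (∑ p ∈ S, d p))
  have hlim : Tendsto (fun N : ℕ => (m : ℝ) * σ ^ (N + 1)) atTop (𝓝 0) := by
    simpa using ((tendsto_pow_atTop_nhds_zero_of_lt_one hσ0 hσ1).comp
      (tendsto_add_atTop_nat 1)).const_mul (m : ℝ)
  filter_upwards [(Finset.eventually_all S).2 fun p hp => hev p hp,
    hlim.eventually_lt_const hε] with N hN hNε
  have hsq : ({a : ZMod m | IsSquare a}.ncard : ℝ) ≤ (2 / 3) ^ S.card * m :=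
    ncard_isSquare_prod_le hS
  set bad : Set (Fin N → Fin (N + 1) → ℤ) :=
    ⋃ p ∈ S, {R | d p * weight (fun j => ((cofactorVec R j : ℤ) : ZMod p)) ≤ N + 1}
  have hmain := matMeasure_real_isSquare_le bad
    (δ := {a : ZMod m | IsSquare a}.ncard * (1 / m + σ ^ (N + 1))) (by positivity) fun R hR => by
      refine vecMeasure_real_isSquare_le m _ fun a => hσ _ _ a ?_
      refine le_mul_card_of_le_mul_weight (fun p hp => (hS p hp).1) fun p hp => ?_
      have hRp : N + 1 < d p * weight (fun j => ((cofactorVec R j : ℤ) : ZMod p)) := by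
        by_contra! h
        exact hR (Set.mem_iUnion₂.2 ⟨p, hp, h⟩)
      refine hRp.le.trans (Nat.mul_le_mul_right _ ?_)
      exact (Finset.single_le_sum (f := d) (fun _ _ => Nat.zero_le _) hp).trans (Nat.le_succ _)
  have hbad' : (rectMeasure N (N + 1)).real bad ≤ ∑ p ∈ S, 2 / (p : ℝ) :=
    (measureReal_biUnion_finset_le _ _).trans (Finset.sum_le_sum hN)
  have hδ : {a : ZMod m | IsSquare a}.ncard * (1 / m + σ ^ (N + 1)) ≤
      (2 / 3) ^ S.card + m * σ ^ (N + 1) := by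
    calc _ ≤ (2 / 3) ^ S.card * m * (1 / m + σ ^ (N + 1)) := by gcongr
      _ = (2 / 3) ^ S.card + (2 / 3) ^ S.card * (m * σ ^ (N + 1)) := by field_simp
      _ ≤ _ := by
        have hpow : (2 / 3 : ℝ) ^ S.card ≤ 1 := pow_le_one₀ (by norm_num) (by norm_num)
        exact add_le_add_right (mul_le_of_le_one_left (by positivity) hpow) _
  linarith

lemma exists_finset_primes {ε : ℝ} (hε : 0 < ε) : ∃ S : Finset ℕ, (∀ p ∈ S, p.Prime ∧ 6 ≤ p) ∧
    ∑ p ∈ S, 2 / (p : ℝ) + (2 / 3) ^ S.card < ε := by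
  obtain ⟨k, hk⟩ := exists_pow_lt_of_lt_one (half_pos hε) (show (2 / 3 : ℝ) < 1 by norm_num)
  obtain ⟨B, hB⟩ := exists_nat_gt (4 * k / ε)
  have hinf : {p : ℕ | p.Prime ∧ B + 6 ≤ p}.Infinite := by
    rw [Set.infinite_iff_exists_gt]
    intro a
    obtain ⟨p, hp, hpp⟩ := Nat.exists_infinite_primes (a + 1 + (B + 6))
    exact ⟨p, ⟨hpp, by omega⟩, by omega⟩
  obtain ⟨S, hS, hcard⟩ := hinf.exists_subset_card_eq k
  refine ⟨S, fun p hp => ⟨(hS hp).1, by have := (hS hp).2; omega⟩, ?_⟩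
  have hB6 : (0 : ℝ) < B + 6 := by positivity
  have hsum : ∑ p ∈ S, 2 / (p : ℝ) ≤ k * (2 / (B + 6)) := by
    rw [← hcard, ← nsmul_eq_mul]
    refine Finset.sum_le_card_nsmul _ _ _ fun p hp => ?_
    have h : ((B + 6 : ℕ) : ℝ) ≤ p := Nat.cast_le.2 (hS hp).2
    push_cast at h
    gcongr
  have hsmall : (k : ℝ) * (2 / (B + 6)) ≤ ε / 2 := by
    rw [div_lt_iff₀ hε] at hB
    rw [mul_div_assoc', div_le_iff₀ hB6]
    nlinarith
  rw [hcard]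
  linarith

end Determinant

/-- The probability that the determinant of an `n × n` random `{0, ±1}` matrix
(entries i.i.d., `0` w.p. `1/2`, `±1` w.p. `1/4` each) is a perfect square
tends to `0` as `n → ∞`. -/
theorem det_square_prob_tendsto_zero :
    Filter.Tendsto
      (fun n : ℕ => matMeasure n {M | ∃ k : ℤ, (Matrix.of M).det = k ^ 2})
      Filter.atTop (nhds 0) := by
  rw [← Filter.tendsto_add_atTop_iff_nat 1,
    ← ENNReal.tendsto_toReal_iff (fun _ => measure_ne_top _ _) ENNReal.zero_ne_top,
    ENNReal.toReal_zero]
  refine tendsto_order.2 ⟨fun a ha => .of_forall fun N => ha.trans_le ENNReal.toReal_nonneg,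
    fun ε hε => ?_⟩
  obtain ⟨S, hS, hSε⟩ := exists_finset_primes hε
  filter_upwards [eventually_matMeasure_real_isSquare_lt hS (sub_pos.2 hSε)] with N hN
  exact hN.trans_eq (by ring)
end

section
/- There exists an absolute constant $C>0$ such that for every $n\ge 2$, if $M$ is an $n\times n$ random matrix whose entries are i.i.d., each taking the value $0$ with probability $1/2$ and each of the values $1$ and $-1$ with probability $1/4$, then $\mathbb{P}(\exists k\in\mathbb{Z}\text{ such that }\det M=k^{2})\le C\, n^{-1/6}(\log n)^{2}$. -/
open MeasureTheory

/-- The four equally likely outcomes realising the law of an entry. -/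
def entryValue : Fin 4 → ℤ := ![0, 1, 0, -1]

theorem one_div_le_norm_one_sub_of_pow_eq_one {m : ℕ} {z : ℂ} (hm : 0 < m)
    (hz : z ^ m = 1) (hz1 : z ≠ 1) : 1 / (m : ℝ) ≤ ‖1 - z‖ := by
  have hm' : (0 : ℝ) < m := by exact_mod_cast hm
  have hn : ‖z‖ = 1 := Complex.norm_eq_one_of_pow_eq_one hz hm.ne'
  have hgeom : ∑ j ∈ Finset.range m, z ^ j = 0 := by
    rw [geom_sum_eq hz1, hz]; simp
  have hstep : ∀ j ∈ Finset.range m, ‖1 - z ^ j‖ ≤ m * ‖1 - z‖ := by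
    intro j hj
    rw [← mul_neg_geom_sum z j, norm_mul, mul_comm]
    refine mul_le_mul_of_nonneg_right ?_ (norm_nonneg _)
    refine (norm_sum_le _ _).trans ?_
    simp only [norm_pow, hn, one_pow, Finset.sum_const, Finset.card_range, nsmul_eq_mul, mul_one]
    exact_mod_cast (Finset.mem_range.mp hj).le
  have hsum : (m : ℝ) ≤ m * (m * ‖1 - z‖) := by
    calc (m : ℝ) = ‖∑ j ∈ Finset.range m, (1 - z ^ j)‖ := by
          rw [Finset.sum_sub_distrib, hgeom]; simp
      _ ≤ ∑ j ∈ Finset.range m, ‖1 - z ^ j‖ := norm_sum_le _ _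
      _ ≤ ∑ _j ∈ Finset.range m, m * ‖1 - z‖ := Finset.sum_le_sum hstep
      _ = m * (m * ‖1 - z‖) := by simp
  rw [div_le_iff₀ hm']
  nlinarith

theorem norm_entry_char_sum_le {m : ℕ} {z : ℂ} (hm : 0 < m) (hz : z ^ m = 1) (hz1 : z ≠ 1) :
    ‖2 + z + z⁻¹‖ ≤ 4 * Real.exp (-(1 / (4 * (m : ℝ) ^ 2))) := by
  have hm' : (0 : ℝ) < m := by exact_mod_cast hm
  have hn : ‖z‖ = 1 := Complex.norm_eq_one_of_pow_eq_one hz hm.ne'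
  have hre : (1 / (m : ℝ)) ^ 2 ≤ 2 - 2 * z.re := by
    have h := one_div_le_norm_one_sub_of_pow_eq_one hm hz hz1
    have h2 : ‖1 - z‖ ^ 2 = 2 - 2 * z.re := by
      have h3 : ‖z‖ ^ 2 = 1 := by rw [hn, one_pow]
      rw [← Complex.normSq_eq_norm_sq, Complex.normSq_apply] at h3 ⊢
      simp only [Complex.sub_re, Complex.one_re, Complex.sub_im, Complex.one_im]
      linarith
    rw [← h2]
    exact pow_le_pow_left₀ (by positivity) h 2
  have hre1 : -1 ≤ z.re := by
    have := Complex.abs_re_le_norm z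
    rw [hn, abs_le] at this
    exact this.1
  have hinv : z⁻¹ = (starRingEnd ℂ) z := Complex.inv_eq_conj hn
  have heq : 2 + z + z⁻¹ = ((2 + 2 * z.re : ℝ) : ℂ) := by
    rw [hinv, add_assoc, Complex.add_conj]; push_cast; ring
  rw [heq, Complex.norm_real, Real.norm_eq_abs, abs_of_nonneg (by linarith)]
  have hexp := Real.add_one_le_exp (-(1 / (4 * (m : ℝ) ^ 2)))
  have : 1 / (4 * (m : ℝ) ^ 2) = (1 / (m : ℝ)) ^ 2 / 4 := by field_simp
  rw [this] at hexp ⊢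
  linarith

section Fourier

variable {ι : Type*} [Fintype ι] [DecidableEq ι]

theorem AddChar.map_finset_sum {A M κ : Type*} [AddCommMonoid A] [CommMonoid M] (ψ : AddChar A M)
    (s : Finset κ) (f : κ → A) : ψ (∑ i ∈ s, f i) = ∏ i ∈ s, ψ (f i) := by
  classical
  induction s using Finset.induction_on with
  | empty => simp
  | insert i s hi ih => rw [Finset.sum_insert hi, Finset.prod_insert hi, AddChar.map_add_eq_mul, ih]

open Finset in
theorem mul_card_filter_eq_char_sum (m : ℕ) [NeZero m] (c : ι → ZMod m) (a : ZMod m) :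
    (m : ℂ) * #{x : ι → Fin 4 | ∑ i, c i * entryValue (x i) = a} =
      ∑ t : ZMod m, ZMod.stdAddChar (-(t * a)) *
        ∏ i, ∑ k : Fin 4, ZMod.stdAddChar (t * c i * (entryValue k : ZMod m)) := by
  simp_rw [Finset.prod_univ_sum, Fintype.piFinset_univ, Finset.mul_sum]
  rw [Finset.sum_comm]
  have key : ∀ x : ι → Fin 4, ∑ t : ZMod m, (ZMod.stdAddChar (-(t * a)) *
      ∏ i, ZMod.stdAddChar (t * c i * (entryValue (x i) : ZMod m)) : ℂ) =
      if ∑ i, c i * entryValue (x i) = a then (m : ℂ) else 0 := by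
    intro x
    have := AddChar.sum_mulShift (∑ i, c i * entryValue (x i) - a) (ZMod.isPrimitive_stdAddChar m)
    simp only [sub_eq_zero, ZMod.card, Nat.cast_ite, Nat.cast_zero] at this
    rw [← this]
    refine Finset.sum_congr rfl fun t _ => ?_
    rw [← AddChar.map_finset_sum, ← AddChar.map_add_eq_mul]
    congr 1
    rw [mul_sub, Finset.mul_sum]
    simp_rw [mul_assoc]
    ring
  rw [Finset.sum_congr rfl fun x _ => key x, ← Finset.sum_filter]
  simp [mul_comm]

open Finset in
/-- Equidistribution modulo `m` of a linear form with sufficiently many coefficients that are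
not annihilated by any given nonzero residue. -/
theorem abs_card_sub_le (m : ℕ) [NeZero m] (c : ι → ZMod m) (a : ZMod m) (s : ℕ)
    (hc : ∀ t : ZMod m, t ≠ 0 → s ≤ #{i | t * c i ≠ 0}) :
    |(#{x : ι → Fin 4 | ∑ i, c i * entryValue (x i) = a} : ℝ) - 4 ^ Fintype.card ι / m| ≤
      4 ^ Fintype.card ι * Real.exp (-(s / (4 * (m : ℝ) ^ 2))) := by
  have hm0 : 0 < m := Nat.pos_of_ne_zero (NeZero.ne m)
  have hm' : (0 : ℝ) < m := by exact_mod_cast hm0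
  set N : ℝ := 4 ^ Fintype.card ι with hN
  set A := #{x : ι → Fin 4 | ∑ i, c i * entryValue (x i) = a}
  set F : ZMod m → ℂ := fun t => ZMod.stdAddChar (-(t * a)) *
        ∏ i, ∑ k : Fin 4, ZMod.stdAddChar (t * c i * (entryValue k : ZMod m)) with hF
  have h0 : F 0 = (N : ℂ) := by simp [hF, hN]
  have hnorm : ∀ u : ZMod m, ‖(ZMod.stdAddChar u : ℂ)‖ = 1 := fun u => AddChar.norm_apply _ _
  have hroot : ∀ u : ZMod m, (ZMod.stdAddChar u : ℂ) ^ m = 1 := by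
    intro u
    rw [← AddChar.map_nsmul_eq_pow]
    simp
  have hinner : ∀ u : ZMod m, (∑ k : Fin 4, ZMod.stdAddChar (u * (entryValue k : ZMod m)) : ℂ) =
      2 + ZMod.stdAddChar u + (ZMod.stdAddChar u)⁻¹ := by
    intro u
    simp [Fin.sum_univ_four, entryValue, AddChar.map_neg_eq_inv]
    ring
  have hFt : ∀ t ≠ 0, ‖F t‖ ≤ N * Real.exp (-(s / (4 * (m : ℝ) ^ 2))) := by
    intro t ht
    simp only [hF, norm_mul, norm_prod, hnorm, one_mul, hinner]
    have hle : ∀ i ∈ univ, ‖2 + (ZMod.stdAddChar (t * c i) : ℂ) + (ZMod.stdAddChar (t * c i))⁻¹‖ ≤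
        4 * (if t * c i ≠ 0 then Real.exp (-(1 / (4 * (m : ℝ) ^ 2))) else 1) := by
      intro i _
      split_ifs with h
      · refine norm_entry_char_sum_le hm0 (hroot _) ?_
        intro h1
        apply h
        apply ZMod.injective_stdAddChar (N := m)
        simpa using h1
      · rw [not_not] at h
        rw [h]; norm_num
    refine (Finset.prod_le_prod (fun _ _ => norm_nonneg _) hle).trans ?_
    rw [Finset.prod_mul_distrib, Finset.prod_const, Finset.card_univ]
    refine mul_le_mul_of_nonneg_left ?_ (by positivity)
    rw [Finset.prod_ite, Finset.prod_const, Finset.prod_const_one, mul_one, ← Real.exp_nat_mul]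
    refine Real.exp_le_exp.mpr ?_
    rw [mul_neg, neg_le_neg_iff, mul_one_div]
    gcongr
    exact hc t ht
  have hmain := mul_card_filter_eq_char_sum m c a
  rw [← Finset.add_sum_erase _ _ (Finset.mem_univ (0 : ZMod m))] at hmain
  change (m : ℂ) * A = F 0 + ∑ t ∈ univ.erase 0, F t at hmain
  have hdiff : ((m * A - N : ℝ) : ℂ) = ∑ t ∈ univ.erase 0, F t := by
    push_cast; rw [hmain, h0]; ring
  have hbound : |m * A - N| ≤ m * (N * Real.exp (-(s / (4 * (m : ℝ) ^ 2)))) := by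
    rw [← Real.norm_eq_abs, ← Complex.norm_real, hdiff]
    refine (norm_sum_le _ _).trans ((Finset.sum_le_sum fun t ht =>
      hFt t (Finset.ne_of_mem_erase ht)).trans ?_)
    rw [Finset.sum_const, nsmul_eq_mul]
    refine mul_le_mul_of_nonneg_right ?_ (by positivity)
    refine Nat.cast_le.mpr ((Finset.card_erase_le).trans ?_)
    simp
  have hA : (A : ℝ) - N / m = (m * A - N) / m := by field_simp
  rw [hA, abs_div, abs_of_pos hm', div_le_iff₀ hm']
  linarith

end Fourier

section Sparse

variable {ι : Type*} [Fintype ι] [DecidableEq ι] {p : ℕ} [Fact p.Prime]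

open Finset in
theorem two_mul_card_zero_le (v : ι → ZMod p) (hv : v ≠ 0) :
    2 * #{x : ι → Fin 4 | ∑ i, v i * entryValue (x i) = 0} ≤ 4 ^ Fintype.card ι := by
  obtain ⟨i, hi⟩ := Function.ne_iff.mp hv
  set T : (ι → Fin 4) → (ι → Fin 4) := fun x => Function.update x i (x i + 1) with hT
  have hTinj : Function.Injective T := by
    intro x y hxy
    funext j
    have hj := congrFun hxy j
    by_cases hji : j = i
    · subst hji; simpa [hT] using hj
    · simpa [hT, hji] using hj
  set A := ({x : ι → Fin 4 | ∑ i, v i * entryValue (x i) = 0} : Finset _)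
  have hdisj : Disjoint A (A.image T) := by
    rw [Finset.disjoint_left]
    intro y hy hy'
    obtain ⟨x, hx, rfl⟩ := Finset.mem_image.mp hy'
    simp only [A, Finset.mem_filter, Finset.mem_univ, true_and] at hx hy
    rw [← Finset.add_sum_erase _ _ (Finset.mem_univ i)] at hx hy
    have hrest : ∑ j ∈ univ.erase i, v j * (entryValue (T x j) : ZMod p) =
        ∑ j ∈ univ.erase i, v j * (entryValue (x j) : ZMod p) :=
      Finset.sum_congr rfl fun j hj => by simp [hT, Finset.ne_of_mem_erase hj]
    rw [hrest] at hy
    have h := add_right_cancel (hx.trans hy.symm)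
    have h' := mul_left_cancel₀ hi h
    simp only [hT, Function.update_self] at h'
    generalize x i = k at h'
    fin_cases k <;> simp [entryValue] at h'
  have hcard := Finset.card_le_univ (A ∪ A.image T)
  rw [Finset.card_union_of_disjoint hdisj, Finset.card_image_of_injective _ hTinj] at hcard
  simp at hcard
  omega

open Finset in
theorem card_sparse_le (hι : 0 < Fintype.card ι) (s : ℕ) :
    #{v : ι → ZMod p | #{i | v i ≠ 0} ≤ s} ≤ (Fintype.card ι * p) ^ s := by
  have hp : 0 < p := (Fact.out : p.Prime).pos
  obtain ⟨i₀⟩ : Nonempty ι := Fintype.card_pos_iff.mp hι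
  have hsurj : ∀ s : ℕ, ∀ v : ι → ZMod p, #{i | v i ≠ 0} ≤ s →
      ∃ u : Fin s → ι × ZMod p, v = ∑ k, Pi.single (u k).1 (u k).2 := by
    intro s
    induction s with
    | zero =>
      intro v hv
      refine ⟨Fin.elim0, ?_⟩
      simp only [nonpos_iff_eq_zero, Finset.card_eq_zero, Finset.filter_eq_empty_iff] at hv
      funext i
      simpa using hv (Finset.mem_univ i)
    | succ s ih =>
      intro v hv
      by_cases hv0 : v = 0
      · refine ⟨fun _ => (i₀, 0), ?_⟩
        simp [hv0]
      · obtain ⟨i, hi⟩ := Function.ne_iff.mp hv0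
        obtain ⟨u, hu⟩ := ih (Function.update v i 0) (by
          have hsub : ({j | Function.update v i 0 j ≠ 0} : Finset ι) ⊂
              ({j | v j ≠ 0} : Finset ι) := by
            refine (Finset.ssubset_iff_of_subset ?_).mpr ⟨i, ?_, ?_⟩
            · intro j hj
              by_cases hji : j = i <;> simp_all
            · simpa using hi
            · simp
          have := Finset.card_lt_card hsub
          omega)
        refine ⟨Fin.cons (i, v i) u, ?_⟩
        rw [Fin.sum_univ_succ]
        simp only [Fin.cons_zero, Fin.cons_succ]
        rw [← hu]
        funext j
        by_cases hji : j = i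
        · subst hji; simp
        · simp [hji]
  have hsub : ({v : ι → ZMod p | #{i | v i ≠ 0} ≤ s} : Finset _) ⊆
      univ.image (fun u : Fin s → ι × ZMod p => ∑ k, Pi.single (u k).1 (u k).2) := by
    intro v hv
    obtain ⟨u, hu⟩ := hsurj s v (by simpa using hv)
    exact Finset.mem_image.mpr ⟨u, Finset.mem_univ _, hu.symm⟩
  refine (Finset.card_le_card hsub).trans (Finset.card_image_le.trans ?_)
  simp [ZMod.card]

/-- The rows `R` annihilate a nonzero vector modulo `p` with at most `s` nonzero coordinates. -/
def HasSparseKernel (p s : ℕ) {κ : Type*} (R : κ → ι → Fin 4) : Prop :=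
  ∃ v : ι → ZMod p, v ≠ 0 ∧ Finset.card {i | v i ≠ 0} ≤ s ∧
    ∀ k, ∑ i, v i * (entryValue (R k i) : ZMod p) = 0

open Finset in
theorem card_forall_dot_eq_zero {κ : Type*} [Fintype κ] [DecidableEq κ] (v : ι → ZMod p) :
    #{R : κ → ι → Fin 4 | ∀ k, ∑ i, v i * (entryValue (R k i) : ZMod p) = 0} =
      #{x : ι → Fin 4 | ∑ i, v i * entryValue (x i) = 0} ^ Fintype.card κ := by
  have h : ({R : κ → ι → Fin 4 | ∀ k, ∑ i, v i * (entryValue (R k i) : ZMod p) = 0} : Finset _) =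
      Fintype.piFinset fun _ : κ =>
        ({x : ι → Fin 4 | ∑ i, v i * entryValue (x i) = 0} : Finset _) := by
    ext R
    simp
  rw [h, Fintype.card_piFinset, Finset.prod_const, Finset.card_univ]

open Finset in
theorem card_hasSparseKernel_le {κ : Type*} [Fintype κ] [DecidableEq κ]
    (hι : 0 < Fintype.card ι) (s : ℕ)
    [DecidablePred fun R : κ → ι → Fin 4 => HasSparseKernel p s R] :
    2 ^ Fintype.card κ * #{R : κ → ι → Fin 4 | HasSparseKernel p s R} ≤
      (Fintype.card ι * p) ^ s * (4 ^ Fintype.card ι) ^ Fintype.card κ := by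
  set V : Finset (ι → ZMod p) := {v : ι → ZMod p | v ≠ 0 ∧ #{i | v i ≠ 0} ≤ s}
  have hsub : ({R : κ → ι → Fin 4 | HasSparseKernel p s R} : Finset _) ⊆
      V.biUnion fun v => {R | ∀ k, ∑ i, v i * (entryValue (R k i) : ZMod p) = 0} := by
    intro R hR
    obtain ⟨v, hv0, hvs, hv⟩ := (Finset.mem_filter.mp hR).2
    refine Finset.mem_biUnion.mpr ⟨v, ?_, ?_⟩
    · simp only [V, Finset.mem_filter, Finset.mem_univ, true_and]
      exact ⟨hv0, by convert hvs⟩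
    · simpa using hv
  calc 2 ^ Fintype.card κ * #{R : κ → ι → Fin 4 | HasSparseKernel p s R}
      ≤ 2 ^ Fintype.card κ * ∑ v ∈ V,
          #{R : κ → ι → Fin 4 | ∀ k, ∑ i, v i * (entryValue (R k i) : ZMod p) = 0} := by
        gcongr
        exact (Finset.card_le_card hsub).trans Finset.card_biUnion_le
    _ = ∑ v ∈ V, (2 * #{x : ι → Fin 4 | ∑ i, v i * entryValue (x i) = 0}) ^ Fintype.card κ := by
        rw [Finset.mul_sum]
        refine Finset.sum_congr rfl fun v _ => ?_
        rw [mul_pow, ← card_forall_dot_eq_zero]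
    _ ≤ ∑ _v ∈ V, (4 ^ Fintype.card ι) ^ Fintype.card κ := by
        refine Finset.sum_le_sum fun v hv => Nat.pow_le_pow_left ?_ _
        exact two_mul_card_zero_le v (by simp [V] at hv; exact hv.1)
    _ ≤ (Fintype.card ι * p) ^ s * (4 ^ Fintype.card ι) ^ Fintype.card κ := by
        rw [Finset.sum_const, smul_eq_mul]
        refine Nat.mul_le_mul_right _
          (le_trans (Finset.card_le_card ?_) (card_sparse_le (p := p) hι s))
        intro v hv
        simp only [V, Finset.mem_filter, Finset.mem_univ, true_and] at hv ⊢
        convert hv.2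

end Sparse

/-- The integer matrix with the given outcomes of its entries. -/
def outcomeMatrix {κ ι : Type*} (R : κ → ι → Fin 4) : Matrix κ ι ℤ :=
  Matrix.of fun i j => entryValue (R i j)

section Singular

open Finset in
/-- First moment bound for the kernel of the matrix modulo `p`. -/
theorem card_dvd_det_le {n : ℕ} (hn : 0 < n) (p : ℕ) [Fact p.Prime] (s : ℕ) :
    (#{M : Fin n → Fin n → Fin 4 | (p : ℤ) ∣ (outcomeMatrix M).det} : ℝ) ≤
      ((n * p : ℝ) ^ s / 2 ^ n +
        (1 + p * Real.exp (-(s / (4 * (p : ℝ) ^ 2)))) ^ n / (p - 1)) * ((4 : ℝ) ^ n) ^ n := by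
  classical
  set e := Real.exp (-(s / (4 * (p : ℝ) ^ 2))) with he
  set N : ℝ := 4 ^ n with hN
  have hN0 : 0 < N := by positivity
  have hp1 : (1 : ℝ) < p := by exact_mod_cast (Fact.out : p.Prime).one_lt
  set ker : (Fin n → ZMod p) → Finset (Fin n → Fin n → Fin 4) := fun v =>
    {R | ∀ k, ∑ i, v i * (entryValue (R k i) : ZMod p) = 0} with hker
  set V : Finset (Fin n → ZMod p) := {v | s < #{i | v i ≠ 0}} with hV
  set S : Finset (Fin n → Fin n → Fin 4) := {M | ∃ v ∈ V, M ∈ ker v} with hS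
  set B : Finset (Fin n → Fin n → Fin 4) := {M | HasSparseKernel p s M} with hB
  have hcover : ({M : Fin n → Fin n → Fin 4 | (p : ℤ) ∣ (outcomeMatrix M).det} : Finset _) ⊆
      B ∪ S := by
    intro M hM
    have hdvd : (p : ℤ) ∣ (outcomeMatrix M).det := (Finset.mem_filter.mp hM).2
    have hdet : ((outcomeMatrix M).map (Int.castRingHom (ZMod p))).det = 0 := by
      rw [← RingHom.mapMatrix_apply, ← RingHom.map_det, eq_intCast]
      exact (ZMod.intCast_zmod_eq_zero_iff_dvd _ _).mpr hdvd
    obtain ⟨v, hv0, hv⟩ := Matrix.exists_mulVec_eq_zero_iff.mpr hdet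
    have hv' : ∀ k, ∑ i, v i * (entryValue (M k i) : ZMod p) = 0 := by
      intro k
      have := congrFun hv k
      simp only [Matrix.mulVec, dotProduct, Matrix.map_apply, outcomeMatrix, Matrix.of_apply,
        Pi.zero_apply, eq_intCast] at this
      simpa [mul_comm] using this
    rw [Finset.mem_union]
    by_cases hs : #{i | v i ≠ 0} ≤ s
    · left
      refine Finset.mem_filter.mpr ⟨Finset.mem_univ _, v, hv0, ?_, hv'⟩
      convert hs
    · right
      refine Finset.mem_filter.mpr ⟨Finset.mem_univ _, v, ?_, ?_⟩
      · simpa [hV] using hs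
      · simpa [hker] using hv'
  have hBle : (#B : ℝ) ≤ (n * p : ℝ) ^ s / 2 ^ n * N ^ n := by
    have h := card_hasSparseKernel_le (p := p) (ι := Fin n) (κ := Fin n) (by simpa using hn) s
    rw [Fintype.card_fin] at h
    rw [div_mul_eq_mul_div, le_div_iff₀ (by positivity), mul_comm]
    simp only [hN, hB]
    exact_mod_cast h
  have hkerle : ∀ v ∈ V, (#(ker v) : ℝ) ≤ (N / p * (1 + p * e)) ^ n := by
    intro v hv
    have hcard : #(ker v) = #{x : Fin n → Fin 4 | ∑ i, v i * entryValue (x i) = 0} ^ n := by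
      convert card_forall_dot_eq_zero (κ := Fin n) v
      exact (Fintype.card_fin n).symm
    rw [hcard, Nat.cast_pow]
    refine pow_le_pow_left₀ (by positivity) ?_ n
    have h := abs_card_sub_le p v 0 s (fun t ht => by
      simp only [hV, Finset.mem_filter, Finset.mem_univ, true_and] at hv
      simpa [ht] using hv.le)
    rw [Fintype.card_fin] at h
    have h2 := (abs_le.mp h).2
    have h3 : N / p * (1 + p * e) = N * e + N / p := by field_simp; ring
    rw [h3]
    linarith
  have hSle : ((p : ℝ) - 1) * #S ≤ N ^ n * (1 + p * e) ^ n := by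
    have hfib : ∀ M ∈ S, (p : ℝ) - 1 ≤ ∑ v ∈ V, if M ∈ ker v then (1 : ℝ) else 0 := by
      intro M hM
      obtain ⟨v, hvV, hvM⟩ := (Finset.mem_filter.mp hM).2
      obtain ⟨i, hi⟩ : ∃ i, v i ≠ 0 := by
        simp only [hV, Finset.mem_filter, Finset.mem_univ, true_and] at hvV
        obtain ⟨i, hi⟩ := Finset.card_pos.mp (lt_of_le_of_lt (Nat.zero_le s) hvV)
        exact ⟨i, by simpa using hi⟩
      have hinj : Function.Injective fun u : (ZMod p)ˣ => (u : ZMod p) • v := by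
        intro u w huw
        have := congrFun huw i
        simp only [Pi.smul_apply, smul_eq_mul] at this
        exact Units.ext (mul_right_cancel₀ hi this)
      have hsub : univ.image (fun u : (ZMod p)ˣ => (u : ZMod p) • v) ⊆
          {w ∈ V | M ∈ ker w} := by
        intro w hw
        obtain ⟨u, -, rfl⟩ := Finset.mem_image.mp hw
        refine Finset.mem_filter.mpr ⟨?_, ?_⟩
        · simpa [hV] using hvV
        · simp only [hker, Finset.mem_filter, Finset.mem_univ, true_and, Pi.smul_apply,
            smul_eq_mul] at hvM ⊢
          intro k
          simp_rw [mul_assoc]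
          rw [← Finset.mul_sum, hvM k, mul_zero]
      have hcard := Finset.card_le_card hsub
      rw [Finset.card_image_of_injective _ hinj, Finset.card_univ, ZMod.card_units p] at hcard
      rw [Finset.sum_ite, Finset.sum_const_zero, add_zero, Finset.sum_const, nsmul_eq_mul, mul_one]
      have h1 : 1 ≤ p := (Fact.out : p.Prime).one_lt.le
      have h2 : ((p - 1 : ℕ) : ℝ) = (p : ℝ) - 1 := by push_cast [h1]; ring
      rw [← h2]
      exact_mod_cast hcard
    calc ((p : ℝ) - 1) * #S = ∑ _M ∈ S, ((p : ℝ) - 1) := by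
          rw [Finset.sum_const, nsmul_eq_mul, mul_comm]
      _ ≤ ∑ M ∈ S, ∑ v ∈ V, if M ∈ ker v then (1 : ℝ) else 0 := Finset.sum_le_sum hfib
      _ = ∑ v ∈ V, ∑ M ∈ S, if M ∈ ker v then (1 : ℝ) else 0 := Finset.sum_comm
      _ ≤ ∑ v ∈ V, (#(ker v) : ℝ) := by
          refine Finset.sum_le_sum fun v _ => ?_
          rw [Finset.sum_ite, Finset.sum_const_zero, add_zero, Finset.sum_const, nsmul_eq_mul,
            mul_one]
          exact_mod_cast Finset.card_le_card fun M hM => (Finset.mem_filter.mp hM).2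
      _ ≤ ∑ _v ∈ V, (N / p * (1 + p * e)) ^ n := Finset.sum_le_sum hkerle
      _ = #V * (N / p * (1 + p * e)) ^ n := by rw [Finset.sum_const, nsmul_eq_mul]
      _ ≤ (p : ℝ) ^ n * (N / p * (1 + p * e)) ^ n := by
          have h := Finset.card_le_univ V
          rw [Fintype.card_fun, Fintype.card_fin, ZMod.card] at h
          have h' : (#V : ℝ) ≤ (p : ℝ) ^ n := by exact_mod_cast h
          exact mul_le_mul_of_nonneg_right h' (by positivity)
      _ = N ^ n * (1 + p * e) ^ n := by
          rw [← mul_pow, ← mul_pow]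
          congr 1
          field_simp
  have hSle' : (#S : ℝ) ≤ (1 + p * e) ^ n / (p - 1) * N ^ n := by
    rw [div_mul_eq_mul_div, le_div_iff₀ (by linarith)]
    linarith
  calc (#{M : Fin n → Fin n → Fin 4 | (p : ℤ) ∣ (outcomeMatrix M).det} : ℝ)
      ≤ #B + #S := by
        exact_mod_cast (Finset.card_le_card hcover).trans (Finset.card_union_le _ _)
    _ ≤ _ := by rw [add_mul]; exact add_le_add hBle hSle'

end Singular

section Correlation

open Finset in
theorem abs_sum_comp_linear_le {ι : Type*} [Fintype ι] [DecidableEq ι] (m : ℕ) [NeZero m]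
    (f : ZMod m → ℝ) (hf0 : ∑ a, f a = 0) (hf1 : ∀ a, |f a| ≤ 1) (c : ι → ZMod m) (s : ℕ)
    (hc : ∀ t : ZMod m, t ≠ 0 → s ≤ #{i | t * c i ≠ 0}) :
    |∑ x : ι → Fin 4, f (∑ i, c i * entryValue (x i))| ≤
      m * Real.exp (-(s / (4 * (m : ℝ) ^ 2))) * 4 ^ Fintype.card ι := by
  have hfib : ∑ x : ι → Fin 4, f (∑ i, c i * entryValue (x i)) =
      ∑ a : ZMod m, f a * ((#{x : ι → Fin 4 | ∑ i, c i * entryValue (x i) = a} : ℝ) -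
        4 ^ Fintype.card ι / m) := by
    simp_rw [mul_sub]
    rw [Finset.sum_sub_distrib, ← Finset.sum_mul, hf0, zero_mul, sub_zero,
      ← Finset.sum_fiberwise (s := univ) 
        (g := fun x : ι → Fin 4 => ∑ i, c i * (entryValue (x i) : ZMod m))]
    refine Finset.sum_congr rfl fun a _ => ?_
    rw [Finset.sum_congr rfl fun x hx => by rw [(Finset.mem_filter.mp hx).2], Finset.sum_const,
      nsmul_eq_mul, mul_comm]
  rw [hfib]
  refine (Finset.abs_sum_le_sum_abs _ _).trans ?_
  have hterm : ∀ a ∈ (univ : Finset (ZMod m)),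
      |f a * ((#{x : ι → Fin 4 | ∑ i, c i * entryValue (x i) = a} : ℝ) -
        4 ^ Fintype.card ι / m)| ≤
      4 ^ Fintype.card ι * Real.exp (-(s / (4 * (m : ℝ) ^ 2))) := by
    intro a _
    rw [abs_mul]
    exact (mul_le_of_le_one_left (abs_nonneg _) (hf1 a)).trans (abs_card_sub_le m c a s hc)
  refine (Finset.sum_le_sum hterm).trans (le_of_eq ?_)
  rw [Finset.sum_const, Finset.card_univ, ZMod.card, nsmul_eq_mul]
  ring

/-- The cofactors along the top row, above the remaining rows `R`. -/
def topCofactor {k : ℕ} (R : Fin k → Fin (k + 1) → ℤ) (j : Fin (k + 1)) : ℤ :=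
  (-1) ^ (j : ℕ) * (Matrix.of fun i l => R i (j.succAbove l)).det

theorem det_cons_eq_sum_topCofactor {k : ℕ} (x : Fin (k + 1) → ℤ) (R : Fin k → Fin (k + 1) → ℤ) :
    (Matrix.of (Fin.cons x R : Fin (k + 1) → Fin (k + 1) → ℤ)).det =
      ∑ j, topCofactor R j * x j := by
  rw [Matrix.det_succ_row_zero]
  refine Finset.sum_congr rfl fun j _ => ?_
  simp only [topCofactor, Matrix.of_apply, Fin.cons_zero]
  rw [mul_right_comm]
  rfl

theorem sum_topCofactor_mul_row {k : ℕ} (R : Fin k → Fin (k + 1) → ℤ) (i : Fin k) :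
    ∑ j, topCofactor R j * R i j = 0 := by
  rw [← det_cons_eq_sum_topCofactor]
  exact Matrix.det_zero_of_row_eq (Fin.succ_ne_zero i).symm (by ext; simp)

open Finset in
theorem lt_card_cofactor_ne_zero {k p s : ℕ} (R : Fin k → Fin (k + 1) → Fin 4)
    (hR : ¬ HasSparseKernel p s R)
    (h0 : (fun j => (topCofactor (outcomeMatrix R) j : ZMod p)) ≠ 0) :
    s < #{j | (topCofactor (outcomeMatrix R) j : ZMod p) ≠ 0} := by
  classical
  by_contra hlt
  refine hR ⟨_, h0, ?_, fun i => ?_⟩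
  · convert not_lt.mp hlt
  · have := congrArg (Int.cast : ℤ → ZMod p) (sum_topCofactor_mul_row (outcomeMatrix R) i)
    simpa [outcomeMatrix] using this

theorem abs_legendreSym_le_one (p : ℕ) [Fact p.Prime] (a : ℤ) : |(legendreSym p a : ℝ)| ≤ 1 := by
  by_cases h : (a : ZMod p) = 0
  · simp [(legendreSym.eq_zero_iff p a).mpr h]
  · rcases legendreSym.eq_one_or_neg_one p h with h | h <;> simp [h]

open Finset in
theorem abs_sum_legendreSym_mul_linear_le {ι : Type*} [Fintype ι] [DecidableEq ι] (p q : ℕ)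
    [Fact p.Prime] [Fact q.Prime] (hp2 : p ≠ 2) (hpq : p ≠ q) (c : ι → ℤ) (s : ℕ)
    (hp : s ≤ #{i | (c i : ZMod p) ≠ 0}) (hq : s ≤ #{i | (c i : ZMod q) ≠ 0}) :
    |∑ x : ι → Fin 4, (legendreSym p (∑ i, c i * entryValue (x i)) : ℝ) *
        legendreSym q (∑ i, c i * entryValue (x i))| ≤
      p * q * Real.exp (-(s / (4 * (p * q : ℝ) ^ 2))) * 4 ^ Fintype.card ι := by
  have hcop : p.Coprime q := (Nat.coprime_primes Fact.out Fact.out).mpr hpq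
  have : NeZero (p * q) := ⟨mul_ne_zero (NeZero.ne p) (NeZero.ne q)⟩
  set e := ZMod.chineseRemainder hcop
  set f : ZMod (p * q) → ℝ := fun a =>
    (quadraticChar (ZMod p) (e a).1 : ℝ) * (quadraticChar (ZMod q) (e a).2 : ℝ) with hf
  have he1 : ∀ D : ℤ, (e (D : ZMod (p * q))).1 = (D : ZMod p) := fun D => by
    rw [map_intCast]; rfl
  have he2 : ∀ D : ℤ, (e (D : ZMod (p * q))).2 = (D : ZMod q) := fun D => by
    rw [map_intCast]; rfl
  have hfD : ∀ D : ℤ, f D = (legendreSym p D : ℝ) * legendreSym q D := by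
    intro D
    simp only [hf, he1, he2, legendreSym]
  have hf0 : ∑ a, f a = 0 := by
    have h := Equiv.sum_comp e.toEquiv (fun y : ZMod p × ZMod q =>
      (quadraticChar (ZMod p) y.1 : ℝ) * (quadraticChar (ZMod q) y.2 : ℝ))
    refine h.trans ?_
    rw [Fintype.sum_prod_type]
    simp_rw [← Finset.mul_sum]
    rw [← Finset.sum_mul]
    have h0 := quadraticChar_sum_zero (F := ZMod p) (by rwa [ZMod.ringChar_zmod_n])
    have h0' : ∑ a : ZMod p, (quadraticChar (ZMod p) a : ℝ) = 0 := by exact_mod_cast h0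
    rw [h0', zero_mul]
  have hf1 : ∀ a, |f a| ≤ 1 := by
    intro a
    obtain ⟨D, rfl⟩ := ZMod.intCast_surjective a
    rw [hfD, abs_mul]
    exact mul_le_one₀ (abs_legendreSym_le_one p D) (abs_nonneg _) (abs_legendreSym_le_one q D)
  have hc : ∀ t : ZMod (p * q), t ≠ 0 → s ≤ #{i | t * ((c i : ℤ) : ZMod (p * q)) ≠ 0} := by
    intro t ht
    have ht' : (e t).1 ≠ 0 ∨ (e t).2 ≠ 0 := by
      by_contra hcon
      push Not at hcon
      exact ht (e.injective (by rw [map_zero]; exact Prod.ext hcon.1 hcon.2))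
    rcases ht' with h | h
    · refine hp.trans (Finset.card_le_card fun i hi => ?_)
      simp only [Finset.mem_filter, Finset.mem_univ, true_and] at hi ⊢
      intro h0
      have := congrArg (fun a => (e a).1) h0
      simp only [map_mul, Prod.fst_mul, he1, map_zero, Prod.fst_zero] at this
      exact mul_ne_zero h hi this
    · refine hq.trans (Finset.card_le_card fun i hi => ?_)
      simp only [Finset.mem_filter, Finset.mem_univ, true_and] at hi ⊢
      intro h0
      have := congrArg (fun a => (e a).2) h0
      simp only [map_mul, Prod.snd_mul, he2, map_zero, Prod.snd_zero] at this
      exact mul_ne_zero h hi this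
  have h := abs_sum_comp_linear_le (p * q) f hf0 hf1 (fun i => ((c i : ℤ) : ZMod (p * q))) s hc
  rw [Nat.cast_mul] at h
  refine le_trans (le_of_eq ?_) h
  congr 1
  refine Finset.sum_congr rfl fun x _ => ?_
  rw [← hfD]
  push_cast
  rfl

open Finset in
/-- Legendre symbols of the determinant at distinct primes are almost uncorrelated. -/
theorem abs_sum_legendreSym_mul_det_le (k : ℕ) (p q : ℕ) [Fact p.Prime] [Fact q.Prime]
    (hp2 : p ≠ 2) (hpq : p ≠ q) (s : ℕ) :
    |∑ M : Fin (k + 1) → Fin (k + 1) → Fin 4,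
        (legendreSym p (outcomeMatrix M).det : ℝ) * legendreSym q (outcomeMatrix M).det| ≤
      (((k + 1 : ℕ) * p : ℝ) ^ s / 2 ^ k + ((k + 1 : ℕ) * q : ℝ) ^ s / 2 ^ k +
        p * q * Real.exp (-(s / (4 * (p * q : ℝ) ^ 2)))) * ((4 : ℝ) ^ (k + 1)) ^ (k + 1) := by
  classical
  set N : ℝ := 4 ^ (k + 1) with hN
  have hN0 : 0 < N := by positivity
  set e := Real.exp (-(s / (4 * (p * q : ℝ) ^ 2)))
  set c : (Fin k → Fin (k + 1) → Fin 4) → Fin (k + 1) → ℤ := fun R =>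
    topCofactor (outcomeMatrix R) with hc
  set g : (Fin k → Fin (k + 1) → Fin 4) → ℝ := fun R =>
    ∑ x : Fin (k + 1) → Fin 4, (legendreSym p (∑ i, c R i * entryValue (x i)) : ℝ) *
        legendreSym q (∑ i, c R i * entryValue (x i)) with hg
  have hsplit : ∑ M : Fin (k + 1) → Fin (k + 1) → Fin 4,
      (legendreSym p (outcomeMatrix M).det : ℝ) * legendreSym q (outcomeMatrix M).det =
      ∑ R, g R := by
    rw [← Equiv.sum_comp (Fin.consEquiv fun _ : Fin (k + 1) => Fin (k + 1) → Fin 4),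
      Fintype.sum_prod_type, Finset.sum_comm]
    refine Finset.sum_congr rfl fun R _ => Finset.sum_congr rfl fun x _ => ?_
    have hdet : (outcomeMatrix ((Fin.consEquiv fun _ : Fin (k + 1) => Fin (k + 1) → Fin 4)
        (x, R))).det = ∑ i, c R i * entryValue (x i) := by
      rw [hc, ← det_cons_eq_sum_topCofactor (fun i => entryValue (x i)) (outcomeMatrix R)]
      congr 1
      ext i j
      refine Fin.cases ?_ (fun i => ?_) i <;> rfl
    rw [hdet]
  have hcard_row : ∑ _x : Fin (k + 1) → Fin 4, (1 : ℝ) = N := by simp [hN]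
  have hcard_rows : ∑ _R : Fin k → Fin (k + 1) → Fin 4, (1 : ℝ) = N ^ k := by simp [hN]
  have htriv : ∀ R, |g R| ≤ N := by
    intro R
    rw [← hcard_row]
    refine (Finset.abs_sum_le_sum_abs _ _).trans (Finset.sum_le_sum fun x _ => ?_)
    rw [abs_mul]
    exact mul_le_one₀ (abs_legendreSym_le_one p _) (abs_nonneg _) (abs_legendreSym_le_one q _)
  set bp : (Fin k → Fin (k + 1) → Fin 4) → ℝ := fun R => if HasSparseKernel p s R then 1 else 0
  set bq : (Fin k → Fin (k + 1) → Fin 4) → ℝ := fun R => if HasSparseKernel q s R then 1 else 0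
  have hg_le : ∀ R, |g R| ≤ N * bp R + N * bq R + p * q * e * N := by
    intro R
    have hE : 0 ≤ p * q * e * N := by positivity
    by_cases h1 : HasSparseKernel p s R
    · have hb : 0 ≤ N * bq R := by simp only [bq]; positivity
      have hb1 : bp R = 1 := if_pos h1
      have := htriv R
      rw [hb1]; linarith
    by_cases h2 : HasSparseKernel q s R
    · have hb : 0 ≤ N * bp R := by simp only [bp]; positivity
      have hb1 : bq R = 1 := if_pos h2
      have := htriv R
      rw [hb1]; linarith
    have hb1 : bp R = 0 := if_neg h1
    have hb2 : bq R = 0 := if_neg h2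
    rw [hb1, hb2, mul_zero, add_zero, zero_add]
    have hzero : ∀ (r : ℕ) [Fact r.Prime], (fun j => (c R j : ZMod r)) = 0 →
        ∀ x : Fin (k + 1) → Fin 4, legendreSym r (∑ i, c R i * entryValue (x i)) = 0 := by
      intro r _ hr x
      rw [legendreSym.eq_zero_iff]
      push_cast
      exact Finset.sum_eq_zero fun i _ => by rw [congrFun hr i, Pi.zero_apply, zero_mul]
    by_cases hp0 : (fun j => (c R j : ZMod p)) = 0
    · have : g R = 0 := Finset.sum_eq_zero fun x _ => by rw [hzero p hp0]; simp
      rw [this, abs_zero]; exact hE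
    by_cases hq0 : (fun j => (c R j : ZMod q)) = 0
    · have : g R = 0 := Finset.sum_eq_zero fun x _ => by rw [hzero q hq0]; simp
      rw [this, abs_zero]; exact hE
    have h := abs_sum_legendreSym_mul_linear_le p q hp2 hpq (c R) s
      (lt_card_cofactor_ne_zero R h1 hp0).le (lt_card_cofactor_ne_zero R h2 hq0).le
    rwa [Fintype.card_fin] at h
  have hbad : ∀ (r : ℕ) [Fact r.Prime], ∑ R : Fin k → Fin (k + 1) → Fin 4,
      (if HasSparseKernel r s R then (1 : ℝ) else 0) ≤ ((k + 1 : ℕ) * r : ℝ) ^ s / 2 ^ k * N ^ k := by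
    intro r _
    have h := card_hasSparseKernel_le (p := r) (ι := Fin (k + 1)) (κ := Fin k) (by simp) s
    rw [Fintype.card_fin, Fintype.card_fin] at h
    rw [Finset.sum_boole, div_mul_eq_mul_div, le_div_iff₀ (by positivity), mul_comm]
    simp only [hN]
    exact_mod_cast h
  rw [hsplit]
  calc |∑ R, g R| ≤ ∑ R, (N * bp R + N * bq R + p * q * e * N) :=
        (Finset.abs_sum_le_sum_abs _ _).trans (Finset.sum_le_sum fun R _ => hg_le R)
    _ = N * ∑ R, bp R + N * ∑ R, bq R + p * q * e * N * N ^ k := by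
        rw [Finset.sum_add_distrib, Finset.sum_add_distrib, ← Finset.mul_sum, ← Finset.mul_sum,
          Finset.sum_const, nsmul_eq_mul, mul_comm _ (p * q * e * N), ← hcard_rows]
        simp
    _ ≤ N * (((k + 1 : ℕ) * p : ℝ) ^ s / 2 ^ k * N ^ k) +
        N * (((k + 1 : ℕ) * q : ℝ) ^ s / 2 ^ k * N ^ k) + p * q * e * N * N ^ k := by
        have := hbad p
        have := hbad q
        gcongr
    _ = _ := by rw [pow_succ N k]; ring

end Correlation

section SquareSieve

theorem abs_jacobiSym_le_one (a : ℤ) (b : ℕ) : |(jacobiSym a b : ℝ)| ≤ 1 := by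
  rcases jacobiSym.trichotomy a b with h | h | h <;> simp [h]

open Finset in
/-- Pointwise form of the square sieve. -/
theorem one_le_sieve_of_isSquare (P : Finset ℕ) (hP : ∀ p ∈ P, p.Prime) (hP0 : P.Nonempty)
    (k : ℤ) : (1 : ℝ) ≤ (∑ p ∈ P, (jacobiSym (k ^ 2) p : ℝ)) ^ 2 / (#P : ℝ) ^ 2 +
      2 * (∑ p ∈ P, if (p : ℤ) ∣ k ^ 2 then (1 : ℝ) else 0) / #P := by
  have hL : (0 : ℝ) < #P := by exact_mod_cast hP0.card_pos
  set X := ∑ p ∈ P, (jacobiSym (k ^ 2) p : ℝ)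
  set Z := ∑ p ∈ P, if (p : ℤ) ∣ k ^ 2 then (1 : ℝ) else 0
  have hXZ : (#P : ℝ) ≤ X + Z := by
    rw [← Finset.sum_add_distrib, Finset.card_eq_sum_ones, Nat.cast_sum]
    refine Finset.sum_le_sum fun p hp => ?_
    have hpp := hP p hp
    split_ifs with hdvd
    · have hgcd : (k ^ 2).gcd p ≠ 1 := by
        have h := Int.dvd_coe_gcd hdvd (dvd_refl (p : ℤ))
        intro h1
        rw [h1] at h
        exact hpp.one_lt.ne' (by simpa using Int.natCast_dvd_natCast.mp h)
      rw [jacobiSym.eq_zero_iff.mpr ⟨hpp.ne_zero, hgcd⟩]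
      simp
    · have hgcd : k.gcd p = 1 := by
        rw [Int.gcd_comm]
        refine (Int.isCoprime_iff_gcd_eq_one).mp ?_
        refine (Int.prime_iff_natAbs_prime.mpr (by simpa using hpp)).coprime_iff_not_dvd.mpr ?_
        exact fun h => hdvd (h.trans (dvd_pow_self k two_ne_zero))
      rw [jacobiSym.sq_one' hgcd]
      simp
  have h1 : 1 ≤ X / #P + Z / #P := by
    rw [← add_div, le_div_iff₀ hL]; linarith
  have h2 : X ^ 2 / (#P : ℝ) ^ 2 = (X / #P) ^ 2 := by rw [div_pow]
  rw [h2, mul_div_assoc]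
  nlinarith [sq_nonneg (X / #P - 1)]

open Finset in
/-- The square sieve, applied to an integer-valued function on a finite set. -/
theorem card_isSquare_le {Ω : Type*} [Fintype Ω] (D : Ω → ℤ) (P : Finset ℕ)
    (hP : ∀ p ∈ P, p.Prime) (hP0 : P.Nonempty) {a b : ℝ} (hb0 : 0 ≤ b)
    (ha : ∀ p ∈ P, (#{ω | (p : ℤ) ∣ D ω} : ℝ) ≤ a * Fintype.card Ω)
    (hb : ∀ p ∈ P, ∀ q ∈ P, p ≠ q →
      |∑ ω, (jacobiSym (D ω) p : ℝ) * jacobiSym (D ω) q| ≤ b * Fintype.card Ω)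
    (S : Finset Ω) (hS : ∀ ω ∈ S, ∃ k : ℤ, D ω = k ^ 2) :
    (#S : ℝ) ≤ (1 / #P + b + 2 * a) * Fintype.card Ω := by
  classical
  have hL : (0 : ℝ) < #P := by exact_mod_cast hP0.card_pos
  set T : ℝ := (Fintype.card Ω : ℝ) with hT
  have hT0 : 0 ≤ T := Nat.cast_nonneg _
  set X : Ω → ℝ := fun ω => ∑ p ∈ P, (jacobiSym (D ω) p : ℝ) with hX
  set Z : Ω → ℝ := fun ω => ∑ p ∈ P, if (p : ℤ) ∣ D ω then (1 : ℝ) else 0 with hZ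
  have hX2 : ∑ ω, X ω ^ 2 ≤ #P * T + (#P : ℝ) ^ 2 * (b * T) := by
    have hexp : ∑ ω, X ω ^ 2 =
        ∑ p ∈ P, ∑ q ∈ P, ∑ ω, (jacobiSym (D ω) p : ℝ) * jacobiSym (D ω) q := by
      simp_rw [hX, sq, Finset.sum_mul_sum]
      rw [Finset.sum_comm]
      exact Finset.sum_congr rfl fun p _ => Finset.sum_comm
    have hterm : ∀ p ∈ P, ∀ q ∈ P, ∑ ω, (jacobiSym (D ω) p : ℝ) * jacobiSym (D ω) q ≤
        (if p = q then T else 0) + b * T := by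
      intro p hp q hq
      split_ifs with hpq
      · refine le_add_of_le_of_nonneg ?_ (by positivity)
        have : ∀ ω ∈ (univ : Finset Ω), (jacobiSym (D ω) p : ℝ) * jacobiSym (D ω) q ≤ 1 := by
          intro ω _
          refine (le_abs_self _).trans ?_
          rw [abs_mul]
          exact mul_le_one₀ (abs_jacobiSym_le_one _ _) (abs_nonneg _) (abs_jacobiSym_le_one _ _)
        refine (Finset.sum_le_sum this).trans (by simp [hT])
      · rw [zero_add]
        exact (le_abs_self _).trans (hb p hp q hq hpq)
    rw [hexp]
    refine (Finset.sum_le_sum fun p hp => Finset.sum_le_sum (hterm p hp)).trans (le_of_eq ?_)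
    simp_rw [Finset.sum_add_distrib, Finset.sum_ite_eq]
    rw [Finset.sum_congr rfl fun p hp => if_pos hp]
    simp only [Finset.sum_const, nsmul_eq_mul]
    ring
  have hZ1 : ∑ ω, Z ω ≤ #P * (a * T) := by
    simp_rw [hZ]
    rw [Finset.sum_comm, ← nsmul_eq_mul, ← Finset.sum_const]
    refine Finset.sum_le_sum fun p hp => ?_
    rw [Finset.sum_boole]
    exact ha p hp
  calc (#S : ℝ) = ∑ _ω ∈ S, (1 : ℝ) := by simp
    _ ≤ ∑ ω ∈ S, (X ω ^ 2 / (#P : ℝ) ^ 2 + 2 * Z ω / #P) := by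
        refine Finset.sum_le_sum fun ω hω => ?_
        obtain ⟨k, hk⟩ := hS ω hω
        simp only [hX, hZ, hk]
        exact one_le_sieve_of_isSquare P hP hP0 k
    _ ≤ ∑ ω, (X ω ^ 2 / (#P : ℝ) ^ 2 + 2 * Z ω / #P) := by
        refine Finset.sum_le_sum_of_subset_of_nonneg (Finset.subset_univ _) fun ω _ _ => ?_
        have : 0 ≤ Z ω := Finset.sum_nonneg fun p _ => by split_ifs <;> norm_num
        positivity
    _ = (∑ ω, X ω ^ 2) / (#P : ℝ) ^ 2 + 2 * (∑ ω, Z ω) / #P := by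
        rw [Finset.sum_add_distrib, Finset.sum_div, Finset.mul_sum, Finset.sum_div]
    _ ≤ (#P * T + (#P : ℝ) ^ 2 * (b * T)) / (#P : ℝ) ^ 2 + 2 * (#P * (a * T)) / #P := by
        gcongr
    _ = (1 / #P + b + 2 * a) * T := by field_simp

end SquareSieve

section Transfer

/-- The uniform probability measure on `Fin 4`. -/
noncomputable def uniformFour : Measure (Fin 4) :=
  (1/4 : ENNReal) • (Measure.dirac 0 + Measure.dirac 1 + Measure.dirac 2 + Measure.dirac 3)

theorem uniformFour_singleton (k : Fin 4) : uniformFour {k} = 4⁻¹ := by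
  fin_cases k <;> simp [uniformFour]

instance : IsProbabilityMeasure uniformFour := by
  constructor
  simp only [uniformFour, Measure.smul_apply, Measure.add_apply, measure_univ, smul_eq_mul]
  rw [show (1 + 1 + 1 + 1 : ENNReal) = 4 by norm_num, one_div]
  exact ENNReal.inv_mul_cancel (by norm_num) (by norm_num)

theorem map_entryValue_uniformFour : uniformFour.map entryValue = entryMeasure := by
  have hm : Measurable entryValue := measurable_of_finite _
  have h2 : (1/2 : ENNReal) = 1/4 + 1/4 := by
    rw [← two_mul, one_div, one_div, show (4 : ENNReal) = 2 * 2 by norm_num,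
      ENNReal.mul_inv (by norm_num) (by norm_num), ← mul_assoc,
      ENNReal.mul_inv_cancel (by norm_num) (by norm_num), one_mul]
  rw [uniformFour, Measure.map_smul, Measure.map_add _ _ hm, Measure.map_add _ _ hm,
    Measure.map_add _ _ hm, Measure.map_dirac' hm, Measure.map_dirac' hm, Measure.map_dirac' hm,
    Measure.map_dirac' hm, entryMeasure, h2]
  simp only [entryValue, smul_add, add_smul]
  simp
  abel

theorem map_outcomeMatrix_eq_matMeasure (n : ℕ) :
    (Measure.pi fun _ : Fin n => Measure.pi fun _ : Fin n => uniformFour).map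
      (fun (M : Fin n → Fin n → Fin 4) i j => entryValue (M i j)) = matMeasure n := by
  have hm : Measurable entryValue := measurable_of_finite _
  have hrow : (Measure.pi fun _ : Fin n => uniformFour).map
      (fun (x : Fin n → Fin 4) j => entryValue (x j)) = vecMeasure n := by
    have : ∀ _ : Fin n, SigmaFinite (uniformFour.map entryValue) := by
      intro _; rw [map_entryValue_uniformFour]; infer_instance
    rw [Measure.pi_map_pi (fun _ => hm.aemeasurable), vecMeasure]
    simp_rw [map_entryValue_uniformFour]
  have hmr : Measurable (fun (x : Fin n → Fin 4) j => entryValue (x j)) := measurable_of_finite _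
  have : ∀ _ : Fin n, SigmaFinite ((Measure.pi fun _ : Fin n => uniformFour).map
      (fun (x : Fin n → Fin 4) j => entryValue (x j))) := by
    intro _; rw [hrow]; infer_instance
  rw [matMeasure, Measure.pi_map_pi (f := fun _ (x : Fin n → Fin 4) j => entryValue (x j))
    (fun _ => hmr.aemeasurable)]
  simp_rw [hrow]

open Finset in
theorem matMeasure_toReal_eq (n : ℕ) (S : Set (Fin n → Fin n → ℤ))
    [DecidablePred fun M : Fin n → Fin n → Fin 4 => (fun i j => entryValue (M i j)) ∈ S] :
    (matMeasure n S).toReal =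
      #{M : Fin n → Fin n → Fin 4 | (fun i j => entryValue (M i j)) ∈ S} / ((4 : ℝ) ^ n) ^ n := by
  have hm : Measurable (fun (M : Fin n → Fin n → Fin 4) i j => entryValue (M i j)) :=
    measurable_of_finite _
  rw [← map_outcomeMatrix_eq_matMeasure, Measure.map_apply hm (Set.to_countable S).measurableSet]
  have hset : (fun (M : Fin n → Fin n → Fin 4) i j => entryValue (M i j)) ⁻¹' S =
      (({M | (fun i j => entryValue (M i j)) ∈ S} : Finset (Fin n → Fin n → Fin 4)) : Set _) := by
    ext M; simp
  rw [hset, ← sum_measure_singleton]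
  simp only [Measure.pi_singleton, uniformFour_singleton, Finset.prod_const, Finset.card_univ,
    Fintype.card_fin, Finset.sum_const, nsmul_eq_mul]
  rw [ENNReal.toReal_mul, ENNReal.toReal_natCast, ENNReal.toReal_pow, ENNReal.toReal_pow,
    ENNReal.toReal_inv, div_eq_mul_inv, ENNReal.toReal_ofNat, inv_pow, inv_pow]

end Transfer

section Asymptotics

open Filter Real

theorem eventually_log_le_mul_rpow {r ε : ℝ} (hr : 0 < r) (hε : 0 < ε) :
    ∀ᶠ x : ℝ in atTop, log x ≤ ε * x ^ r := by
  filter_upwards [(isLittleO_log_rpow_atTop hr).bound hε, eventually_ge_atTop 1] with x hx hx1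
  rwa [norm_of_nonneg (log_nonneg hx1), norm_of_nonneg (by positivity)] at hx

theorem eventually_le_primeCounting :
    ∀ᶠ x : ℝ in atTop, 2 * x ^ (5 / 6 : ℝ) + 2 ≤ Nat.primeCounting ⌊x⌋₊ := by
  filter_upwards [eventually_log_le_mul_rpow (r := 1 / 6) (ε := 1 / 20) (by norm_num) (by norm_num),
    eventually_ge_atTop 3] with x hlog hx3
  have hx0 : 0 < x := by linarith
  have hlog0 : 0 < log x := log_pos (by linarith)
  refine le_trans ?_ (Chebyshev.pi_ge' (by linarith : 1 < x))
  rw [le_div_iff₀ hlog0]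
  have hmul : x ^ (5 / 6 : ℝ) * x ^ (1 / 6 : ℝ) = x := by
    rw [← rpow_add hx0]; norm_num
  have h56 : 1 ≤ x ^ (5 / 6 : ℝ) := one_le_rpow (by linarith) (by norm_num)
  have h16 : 1 ≤ x ^ (1 / 6 : ℝ) := one_le_rpow (by linarith) (by norm_num)
  have hlog2 : log (x + 2) ≤ 2 * log x := by
    rw [← log_rpow hx0]
    refine log_le_log (by linarith) ?_
    norm_num
    nlinarith
  have hl2 := log_two_gt_d9
  have h1 : x ^ (5 / 6 : ℝ) * log x ≤ x / 20 := by
    calc x ^ (5 / 6 : ℝ) * log x ≤ x ^ (5 / 6 : ℝ) * (1 / 20 * x ^ (1 / 6 : ℝ)) := by gcongr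
      _ = x / 20 := by linear_combination hmul / 20
  have h2 : log x ≤ x / 20 := by nlinarith
  nlinarith

theorem eventually_sparse_negligible :
    ∀ᶠ x : ℝ in atTop, 2 * (16 * x ^ (4 / 5 : ℝ) * log x + 1) * log x + log x ≤
      (x - 1) * log 2 := by
  filter_upwards [eventually_log_le_mul_rpow (r := 1 / 10) (ε := 1 / 20) (by norm_num)
    (by norm_num), eventually_ge_atTop 3] with x hlog hx3
  have hx0 : 0 < x := by linarith
  have hlog0 : 0 < log x := log_pos (by linarith)
  have h1 : x ^ (1 / 10 : ℝ) ≤ x := by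
    conv_rhs => rw [← rpow_one x]
    exact rpow_le_rpow_of_exponent_le (by linarith) (by norm_num)
  have h2 : log x ^ 2 ≤ (1 / 20 * x ^ (1 / 10 : ℝ)) ^ 2 := pow_le_pow_left₀ hlog0.le hlog 2
  have h3 : x ^ (4 / 5 : ℝ) * (x ^ (1 / 10 : ℝ)) ^ 2 = x := by
    rw [← rpow_natCast, ← rpow_mul hx0.le, ← rpow_add hx0]; norm_num
  have h4 : x ^ (4 / 5 : ℝ) * log x ^ 2 ≤ x / 400 := by
    calc x ^ (4 / 5 : ℝ) * log x ^ 2 ≤ x ^ (4 / 5 : ℝ) * (1 / 20 * x ^ (1 / 10 : ℝ)) ^ 2 := by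
          gcongr
      _ = x / 400 := by linear_combination h3 / 400
  have hl2 := log_two_gt_d9
  nlinarith

end Asymptotics

section Main

open Filter Real

theorem sparse_term_le {k s : ℕ} {x : ℝ} (hx : x = (k + 1 : ℕ)) {r : ℝ} (hr0 : 0 ≤ r) (hr : r ≤ x)
    (hs : 2 * s * log x + log x ≤ (x - 1) * log 2) : (x * r) ^ s / 2 ^ k ≤ 1 / x := by
  have hx0 : 0 < x := by rw [hx]; positivity
  rw [div_le_div_iff₀ (by positivity) hx0, one_mul]
  have h1 : (x * r) ^ s ≤ exp (2 * s * log x) := by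
    calc (x * r) ^ s ≤ (x ^ 2) ^ s := by
          refine pow_le_pow_left₀ (by positivity) ?_ s
          nlinarith
      _ = exp (2 * s * log x) := by
          rw [← pow_mul, ← exp_log (pow_pos hx0 _), log_pow]
          push_cast
          rfl
  have h2 : (2 : ℝ) ^ k = exp ((x - 1) * log 2) := by
    rw [mul_comm, ← rpow_def_of_pos two_pos, hx]
    push_cast
    rw [add_sub_cancel_right, rpow_natCast]
  calc (x * r) ^ s * x ≤ exp (2 * s * log x) * exp (log x) := by
        rw [exp_log hx0]; gcongr
    _ ≤ 2 ^ k := by rw [h2, ← exp_add]; exact exp_le_exp.mpr hs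

theorem exp_term_le {x m : ℝ} {s : ℕ} (hx : 1 ≤ x) (hm0 : 0 < m) (hm : m ^ 2 ≤ x ^ (4 / 5 : ℝ))
    (hs : 16 * x ^ (4 / 5 : ℝ) * log x ≤ s) : exp (-(s / (4 * m ^ 2))) ≤ 1 / x ^ 4 := by
  have hx0 : 0 < x := by linarith
  have hlog : 0 ≤ log x := log_nonneg hx
  have h : 4 * log x ≤ s / (4 * m ^ 2) := by
    rw [le_div_iff₀ (by positivity)]
    nlinarith
  calc exp (-(s / (4 * m ^ 2))) ≤ exp (-(4 * log x)) := exp_le_exp.mpr (by linarith)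
    _ = 1 / x ^ 4 := by
        rw [exp_neg, one_div, ← exp_log (pow_pos hx0 4), log_pow]
        norm_num

open Finset in
theorem eventually_card_isSquare_det_le : ∀ᶠ n : ℕ in atTop,
    ∀ S : Finset (Fin n → Fin n → Fin 4),
      (∀ M ∈ S, ∃ k : ℤ, (outcomeMatrix M).det = k ^ 2) →
      (#S : ℝ) ≤ 12 * (n : ℝ) ^ (-(1 / 6) : ℝ) * ((4 : ℝ) ^ n) ^ n := by
  have htend : Tendsto (fun n : ℕ => (n : ℝ) ^ (1 / 5 : ℝ)) atTop atTop :=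
    (tendsto_rpow_atTop (by norm_num)).comp tendsto_natCast_atTop_atTop
  filter_upwards [htend.eventually eventually_le_primeCounting,
    tendsto_natCast_atTop_atTop.eventually eventually_sparse_negligible,
    eventually_ge_atTop 64] with n hpi hsp hn S hS
  obtain ⟨k, rfl⟩ : ∃ k, n = k + 1 := ⟨n - 1, by omega⟩
  set x : ℝ := ((k + 1 : ℕ) : ℝ) with hx
  have hx64 : (64 : ℝ) ≤ x := by rw [hx]; exact_mod_cast hn
  have hx0 : 0 < x := by linarith
  have hlog0 : 0 ≤ log x := log_nonneg (by linarith)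
  rw [← rpow_mul hx0.le, show (1 / 5 * (5 / 6) : ℝ) = 1 / 6 by norm_num] at hpi
  set y : ℝ := x ^ (1 / 6 : ℝ) with hy
  have hy2 : 2 ≤ y := by
    have : (2 : ℝ) = 64 ^ (1 / 6 : ℝ) := by
      rw [show (64 : ℝ) = 2 ^ (6 : ℝ) by norm_num, ← rpow_mul (by norm_num)]; norm_num
    rw [this]
    exact rpow_le_rpow (by norm_num) hx64 (by norm_num)
  have hyinv : x ^ (-(1 / 6) : ℝ) = 1 / y := by
    rw [rpow_neg hx0.le]; exact (one_div _).symm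
  have hyx : y ≤ x := by
    conv_rhs => rw [← rpow_one x]
    exact rpow_le_rpow_of_exponent_le (by linarith) (by norm_num)
  have hinvx : 1 / x ≤ 1 / y := one_div_le_one_div_of_le (by linarith) hyx
  set z : ℝ := x ^ (1 / 5 : ℝ) with hz
  have hz1 : 1 ≤ z := one_le_rpow (by linarith) (by norm_num)
  have hzx : z ≤ x := by
    conv_rhs => rw [← rpow_one x]
    exact rpow_le_rpow_of_exponent_le (by linarith) (by norm_num)
  have hz4 : z ^ 4 = x ^ (4 / 5 : ℝ) := by
    rw [hz, ← rpow_natCast, ← rpow_mul hx0.le]; norm_num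
  have hz5 : z ^ 5 = x := by
    rw [hz, ← rpow_natCast, ← rpow_mul hx0.le]; norm_num
  set s : ℕ := ⌈16 * x ^ (4 / 5 : ℝ) * log x⌉₊ with hs
  have hsle : 16 * x ^ (4 / 5 : ℝ) * log x ≤ s := Nat.le_ceil _
  have hsge : (s : ℝ) ≤ 16 * x ^ (4 / 5 : ℝ) * log x + 1 := (Nat.ceil_lt_add_one (by positivity)).le
  have hsp' : 2 * s * log x + log x ≤ (x - 1) * log 2 := by
    refine le_trans ?_ hsp
    gcongr
  set A : ℕ := ⌈y⌉₊
  have hAle : (A : ℝ) ≤ y + 1 := (Nat.ceil_lt_add_one (by linarith)).le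
  set P : Finset ℕ := {p ∈ range (⌊z⌋₊ + 1) | p.Prime ∧ A < p} with hP
  have hPprime : ∀ p ∈ P, p.Prime := fun p hp => (Finset.mem_filter.mp hp).2.1
  have hPle : ∀ p ∈ P, (p : ℝ) ≤ z := fun p hp =>
    (Nat.le_floor_iff (by linarith)).mp
      (Nat.lt_succ_iff.mp (Finset.mem_range.mp (Finset.mem_filter.mp hp).1))
  have hPge : ∀ p ∈ P, y + 1 ≤ p := by
    intro p hp
    have h1 : A + 1 ≤ p := (Finset.mem_filter.mp hp).2.2
    have h2 : ((A + 1 : ℕ) : ℝ) ≤ p := by exact_mod_cast h1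
    have h3 : y ≤ A := Nat.le_ceil _
    push_cast at h2
    linarith
  have hPcard : y ≤ #P := by
    have hsub : ({p ∈ range (⌊z⌋₊ + 1) | p.Prime} : Finset ℕ) ⊆ P ∪ Finset.Icc 1 A := by
      intro p hp
      rw [Finset.mem_filter] at hp
      rw [Finset.mem_union, Finset.mem_Icc, hP, Finset.mem_filter]
      by_cases hpA : A < p
      · exact Or.inl ⟨hp.1, hp.2, hpA⟩
      · exact Or.inr ⟨hp.2.one_lt.le, not_lt.mp hpA⟩
    have hc := (Finset.card_le_card hsub).trans (Finset.card_union_le _ _)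
    rw [Nat.card_Icc, Nat.add_sub_cancel] at hc
    have hc' : Nat.primeCounting ⌊z⌋₊ ≤ #P + A := by
      rwa [Nat.primeCounting, Nat.primeCounting', Nat.count_eq_card_filter_range]
    have hc'' : (Nat.primeCounting ⌊z⌋₊ : ℝ) ≤ #P + A := by exact_mod_cast hc'
    linarith
  have hP0 : P.Nonempty := by
    rw [← Finset.card_pos]
    have : (0 : ℝ) < #P := by linarith
    exact_mod_cast this
  have hT : (Fintype.card (Fin (k + 1) → Fin (k + 1) → Fin 4) : ℝ) =
      ((4 : ℝ) ^ (k + 1)) ^ (k + 1) := by simp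
  have ha : ∀ p ∈ P, (#{M : Fin (k + 1) → Fin (k + 1) → Fin 4 |
      (p : ℤ) ∣ (outcomeMatrix M).det} : ℝ) ≤
      (1 / y + 3 / y) * Fintype.card (Fin (k + 1) → Fin (k + 1) → Fin 4) := by
    intro p hp
    have : Fact p.Prime := ⟨hPprime p hp⟩
    have hp1 := hPge p hp
    have hp2 := hPle p hp
    have hp0 : (0 : ℝ) < p := by linarith
    rw [hT]
    refine (card_dvd_det_le (Nat.succ_pos k) p s).trans ?_
    refine mul_le_mul_of_nonneg_right (add_le_add ?_ ?_) (by positivity)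
    · refine le_trans ?_ ((sparse_term_le hx hp0.le (hp2.trans hzx) hsp').trans hinvx)
      gcongr
      · norm_num
      · exact Nat.le_succ k
    · have he := exp_term_le (m := p) (s := s) (x := x) (by linarith) hp0 (by
        rw [← hz4]
        calc (p : ℝ) ^ 2 ≤ z ^ 2 := pow_le_pow_left₀ hp0.le hp2 2
          _ ≤ z ^ 4 := pow_le_pow_right₀ hz1 (by norm_num)) hsle
      have hpe : p * exp (-(s / (4 * (p : ℝ) ^ 2))) ≤ 1 / x := by
        calc p * exp (-(s / (4 * (p : ℝ) ^ 2))) ≤ x * (1 / x ^ 4) := by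
              gcongr
              exact hp2.trans hzx
          _ = 1 / x * (1 / x ^ 2) := by field_simp
          _ ≤ 1 / x * 1 := by
              gcongr
              rw [div_le_one (by positivity)]
              nlinarith
          _ = 1 / x := mul_one _
      have hpow : (1 + p * exp (-(s / (4 * (p : ℝ) ^ 2)))) ^ (k + 1) ≤ 3 := by
        calc (1 + p * exp (-(s / (4 * (p : ℝ) ^ 2)))) ^ (k + 1) ≤ (exp (1 / x)) ^ (k + 1) := by
              refine pow_le_pow_left₀ (by positivity) ?_ _
              have := add_one_le_exp (1 / x)
              linarith
          _ = exp 1 := by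
              rw [← exp_nat_mul, ← hx, mul_one_div_cancel hx0.ne']
          _ ≤ 3 := by have := exp_one_lt_d9; linarith
      exact div_le_div₀ (by norm_num) hpow (by linarith) (by linarith)
  have hb : ∀ p ∈ P, ∀ q ∈ P, p ≠ q →
      |∑ M : Fin (k + 1) → Fin (k + 1) → Fin 4,
        (jacobiSym (outcomeMatrix M).det p : ℝ) * jacobiSym (outcomeMatrix M).det q| ≤
      (3 / y) * Fintype.card (Fin (k + 1) → Fin (k + 1) → Fin 4) := by
    intro p hp q hq hpq
    have : Fact p.Prime := ⟨hPprime p hp⟩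
    have : Fact q.Prime := ⟨hPprime q hq⟩
    have hp1 := hPge p hp
    have hp2 := hPle p hp
    have hp0 : (0 : ℝ) < p := by linarith
    have hq1 := hPge q hq
    have hq2 := hPle q hq
    have hq0 : (0 : ℝ) < q := by linarith
    have hpne : p ≠ 2 := by
      rintro rfl
      norm_num at hp1
      linarith
    rw [hT]
    simp_rw [← jacobiSym.legendreSym.to_jacobiSym]
    refine (abs_sum_legendreSym_mul_det_le k p q hpne hpq s).trans ?_
    refine mul_le_mul_of_nonneg_right ?_ (by positivity)
    have h1 := (sparse_term_le hx hp0.le (hp2.trans hzx) hsp').trans hinvx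
    have h2 := (sparse_term_le hx hq0.le (hq2.trans hzx) hsp').trans hinvx
    have hpqz : (p * q : ℝ) ≤ z ^ 2 := by rw [sq]; gcongr
    have he := exp_term_le (m := p * q) (s := s) (x := x) (by linarith) (by positivity) (by
      rw [← hz4]
      calc (p * q : ℝ) ^ 2 ≤ (z ^ 2) ^ 2 := pow_le_pow_left₀ (by positivity) hpqz 2
        _ = z ^ 4 := by ring) hsle
    have h3 : p * q * exp (-(s / (4 * (p * q : ℝ) ^ 2))) ≤ 1 / y := by
      refine le_trans ?_ hinvx
      calc p * q * exp (-(s / (4 * (p * q : ℝ) ^ 2))) ≤ x ^ 2 * (1 / x ^ 4) := by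
            gcongr
            exact hpqz.trans (pow_le_pow_left₀ (by linarith) hzx 2)
        _ = 1 / x * (1 / x) := by field_simp
        _ ≤ 1 / x * 1 := by
            gcongr
            rw [div_le_one (by positivity)]
            linarith
        _ = 1 / x := mul_one _
    have h4 : 3 / y = 1 / y + 1 / y + 1 / y := by ring
    rw [h4]
    exact add_le_add (add_le_add h1 h2) h3
  have h := card_isSquare_le (fun M : Fin (k + 1) → Fin (k + 1) → Fin 4 => (outcomeMatrix M).det)
    P hPprime hP0 (by positivity) ha hb S hS
  rw [hT] at h
  refine h.trans (mul_le_mul_of_nonneg_right ?_ (by positivity))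
  have h1 : 1 / (#P : ℝ) ≤ 1 / y := one_div_le_one_div_of_le (by linarith) hPcard
  rw [hyinv]
  calc 1 / (#P : ℝ) + 3 / y + 2 * (1 / y + 3 / y) ≤ 1 / y + 3 / y + 2 * (1 / y + 3 / y) := by
        gcongr
    _ = 12 * (1 / y) := by ring

end Main

/-- There is an absolute constant `C > 0` such that for every `n ≥ 2`, the
probability that the determinant of an `n × n` random `{0, ±1}` matrix is a
perfect square is at most `C * n ^ (-1/6) * (log n) ^ 2`. -/
theorem det_square_prob_le :
    ∃ C : ℝ, 0 < C ∧ ∀ n : ℕ, 2 ≤ n →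
      (matMeasure n {M | ∃ k : ℤ, (Matrix.of M).det = k ^ 2}).toReal ≤
        C * (n : ℝ) ^ (-(1 / 6) : ℝ) * Real.log n ^ 2 := by
  classical
  obtain ⟨n₀, hn₀⟩ := Filter.eventually_atTop.mp eventually_card_isSquare_det_le
  have hl2 : 0 < Real.log 2 := Real.log_pos one_lt_two
  refine ⟨(12 + (n₀ : ℝ) ^ (1 / 6 : ℝ)) / Real.log 2 ^ 2, by positivity, fun n hn => ?_⟩
  have hn0 : (0 : ℝ) < n := by positivity
  have hlog : Real.log 2 ^ 2 ≤ Real.log n ^ 2 :=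
    pow_le_pow_left₀ hl2.le (Real.log_le_log two_pos (by exact_mod_cast hn)) 2
  have hmain : (matMeasure n {M | ∃ k : ℤ, (Matrix.of M).det = k ^ 2}).toReal ≤
      (12 + (n₀ : ℝ) ^ (1 / 6 : ℝ)) * (n : ℝ) ^ (-(1 / 6) : ℝ) := by
    rcases le_total n₀ n with h | h
    · rw [matMeasure_toReal_eq, div_le_iff₀ (by positivity)]
      refine (hn₀ n h _ fun M hM => (Finset.mem_filter.mp hM).2).trans ?_
      gcongr
      exact le_add_of_nonneg_right (by positivity)
    · have h1 : (1 : ℝ) ≤ (n₀ : ℝ) ^ (1 / 6 : ℝ) * (n : ℝ) ^ (-(1 / 6) : ℝ) := by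
        rw [Real.rpow_neg hn0.le, ← div_eq_mul_inv, one_le_div (by positivity)]
        exact Real.rpow_le_rpow hn0.le (by exact_mod_cast h) (by norm_num)
      have h2 : (matMeasure n {M | ∃ k : ℤ, (Matrix.of M).det = k ^ 2}).toReal ≤ 1 :=
        measureReal_le_one
      have h3 : 0 ≤ 12 * (n : ℝ) ^ (-(1 / 6) : ℝ) := by positivity
      linarith
  calc (matMeasure n {M | ∃ k : ℤ, (Matrix.of M).det = k ^ 2}).toReal
      ≤ (12 + (n₀ : ℝ) ^ (1 / 6 : ℝ)) * (n : ℝ) ^ (-(1 / 6) : ℝ) := hmain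
    _ = (12 + (n₀ : ℝ) ^ (1 / 6 : ℝ)) / Real.log 2 ^ 2 * (n : ℝ) ^ (-(1 / 6) : ℝ) *
        Real.log 2 ^ 2 := by field_simp
    _ ≤ _ := by gcongr
end
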